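/- Let Σ be a submanifold of (M,η) with an almost Kähler–Poisson structure of characteristic function γ², and let R̄ and R be the Riemann curvature tensors of M and Σ respectively. Then for all X,Y,Z,V ∈ TΣ: R(X,Y,Z,V) = X^i Y^j Z^k V^l [ R̄_{ijkl} + (∇̂_k Π_{im})(∇̂_l Π_j^m) − (∇̂_l Π_{im})(∇̂_k Π^m_j) ] = R̄(X,Y,Z,V) + γ^{-4} Σ_{A=1}^p [ η(B_A(X),Z) η(B_A(Y),V) − η(B_A(X),V) η(B_A(Y),Z) ], where B_A^{ij} = −γ² ∇̂^i N_A^j. -/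

import Mathlib

open scoped BigOperators

namespace KP

/-- Partial derivative of a real-valued function on `ℝ^k` in the `a`-th coordinate
direction. -/
noncomputable def pd {k : ℕ} (a : Fin k) (f : (Fin k → ℝ) → ℝ) (p : Fin k → ℝ) : ℝ :=
  fderiv ℝ f p (Pi.single a 1)

variable {n m : ℕ}

/-- The Poisson bracket `{f,g} = θ^{ab} (∂_a f)(∂_b g)` associated to a bivector `θ`. -/
noncomputable def pbr (θ : (Fin n → ℝ) → Fin n → Fin n → ℝ)
    (f g : (Fin n → ℝ) → ℝ) (p : Fin n → ℝ) : ℝ :=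
  ∑ a, ∑ b, θ p a b * pd a f p * pd b g p

/-- Antisymmetry of a bivector. -/
def Antisymm (θ : (Fin n → ℝ) → Fin n → Fin n → ℝ) : Prop :=
  ∀ p a b, θ p a b = - θ p b a

/-- The Jacobi identity for a bivector `θ` (so that `θ` is a Poisson bivector). -/
def JacobiId (θ : (Fin n → ℝ) → Fin n → Fin n → ℝ) : Prop :=
  ∀ p a b c, ∑ d, (θ p a d * pd d (fun q => θ q b c) p
    + θ p b d * pd d (fun q => θ q c a) p
    + θ p c d * pd d (fun q => θ q a b) p) = 0

/-- Smoothness of a field with two indices. -/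
def Smooth2 {k l k' : ℕ} (f : (Fin k → ℝ) → Fin l → Fin k' → ℝ) : Prop :=
  ∀ i j, ContDiff ℝ (⊤ : ℕ∞) fun q => f q i j

/-- A Riemannian metric `g` in local coordinates, with given inverse `gi`:
smoothness, symmetry, positive definiteness and the inverse property. -/
def IsMetric {k : ℕ} (g gi : (Fin k → ℝ) → Fin k → Fin k → ℝ) : Prop :=
  Smooth2 g ∧
  (∀ q i j, g q i j = g q j i) ∧
  (∀ (q : Fin k → ℝ) (v : Fin k → ℝ), v ≠ 0 → 0 < ∑ i, ∑ j, g q i j * v i * v j) ∧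
  (∀ q i j, (∑ l, g q i l * gi q l j) = if i = j then (1:ℝ) else 0)

/-- Christoffel symbols `Γ^a_{bc}` of the Levi-Civita connection of the metric `g`
(with inverse `gi`). -/
noncomputable def Chr {k : ℕ} (g gi : (Fin k → ℝ) → Fin k → Fin k → ℝ)
    (q : Fin k → ℝ) (a b c : Fin k) : ℝ :=
  (1/2) * ∑ d, gi q a d *
    (pd b (fun r => g r d c) q + pd c (fun r => g r d b) q - pd d (fun r => g r b c) q)

/-- The Riemann curvature tensor `R^a_{bcd}` of the Levi-Civita connection of `g`,
with the convention `R(e_c, e_d) e_b = R^a_{bcd} e_a`. -/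
noncomputable def Riem {k : ℕ} (g gi : (Fin k → ℝ) → Fin k → Fin k → ℝ)
    (q : Fin k → ℝ) (a b c d : Fin k) : ℝ :=
  pd c (fun r => Chr g gi r a d b) q - pd d (fun r => Chr g gi r a c b) q
  + ∑ e, (Chr g gi q a c e * Chr g gi q e d b - Chr g gi q a d e * Chr g gi q e c b)

/-- The fully lowered curvature tensor `R_{abcd} = g_{ae} R^e_{bcd}`, so that
`R(X,Y,Z,V) = g(R(Z,V)Y, X) = R_{abcd} X^a Y^b Z^c V^d`. -/
noncomputable def RiemL {k : ℕ} (g gi : (Fin k → ℝ) → Fin k → Fin k → ℝ)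
    (q : Fin k → ℝ) (a b c d : Fin k) : ℝ :=
  ∑ e, g q a e * Riem g gi q e b c d

/-- The induced metric `g_{ab} = η_{ij} (∂_a x^i)(∂_b x^j)` on the submanifold `Σ`
embedded via `x` in `(M,η)`. -/
noncomputable def ind (η : (Fin m → ℝ) → Fin m → Fin m → ℝ)
    (x : (Fin n → ℝ) → Fin m → ℝ) (p : Fin n → ℝ) (a b : Fin n) : ℝ :=
  ∑ i, ∑ j, η (x p) i j * pd a (fun q => x q i) p * pd b (fun q => x q j) p

/-- Smoothness of the embedding. -/
def SmoothEmb (x : (Fin n → ℝ) → Fin m → ℝ) : Prop :=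
  ∀ i, ContDiff ℝ (⊤ : ℕ∞) fun q => x q i

/-- `θ` is an almost Kähler–Poisson structure on `Σ` (with induced metric of inverse
`gi`) with characteristic function `γ2`:  `θ` is a smooth Poisson bivector, `γ2` is
smooth and strictly positive, and `γ² g^{ab} = θ^{ap} θ^{bq} g_{pq}`. -/
def IsAKP (η : (Fin m → ℝ) → Fin m → Fin m → ℝ) (x : (Fin n → ℝ) → Fin m → ℝ)
    (θ : (Fin n → ℝ) → Fin n → Fin n → ℝ) (γ2 : (Fin n → ℝ) → ℝ)
    (gi : (Fin n → ℝ) → Fin n → Fin n → ℝ) : Prop :=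
  Antisymm θ ∧ JacobiId θ ∧ Smooth2 θ ∧ Smooth2 gi ∧
  ContDiff ℝ (⊤ : ℕ∞) γ2 ∧ (∀ p, 0 < γ2 p) ∧
  (∀ p a b, (∑ c, ind η x p a c * gi p c b) = if a = b then (1:ℝ) else 0) ∧
  (∀ p a b, γ2 p * gi p a b = ∑ c, ∑ d, θ p a c * θ p b d * ind η x p c d)

/-- `P^{ij} = {x^i, x^j}`. -/
noncomputable def Pbig (x : (Fin n → ℝ) → Fin m → ℝ)
    (θ : (Fin n → ℝ) → Fin n → Fin n → ℝ) (p : Fin n → ℝ) (i j : Fin m) : ℝ :=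
  pbr θ (fun q => x q i) (fun q => x q j) p

/-- The map `P : TM → TM`, `P(X)^i = P^{ij} η_{jk} X^k`. -/
noncomputable def Pmap (η : (Fin m → ℝ) → Fin m → Fin m → ℝ)
    (x : (Fin n → ℝ) → Fin m → ℝ) (θ : (Fin n → ℝ) → Fin n → Fin n → ℝ)
    (p : Fin n → ℝ) (X : Fin m → ℝ) (i : Fin m) : ℝ :=
  ∑ j, ∑ k, Pbig x θ p i j * η (x p) j k * X k

/-- `D^i(u) = γ^{-2} {u, x^k}{x^i, x^l} η_{kl}`. -/
noncomputable def Dop (η : (Fin m → ℝ) → Fin m → Fin m → ℝ)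
    (x : (Fin n → ℝ) → Fin m → ℝ) (θ : (Fin n → ℝ) → Fin n → Fin n → ℝ)
    (γ2 : (Fin n → ℝ) → ℝ) (u : (Fin n → ℝ) → ℝ) (p : Fin n → ℝ) (i : Fin m) : ℝ :=
  (γ2 p)⁻¹ * ∑ k, ∑ l, pbr θ u (fun q => x q k) p
    * pbr θ (fun q => x q i) (fun q => x q l) p * η (x p) k l

/-- `D^{ik} = D^i(x^k)`. -/
noncomputable def Dmat (η : (Fin m → ℝ) → Fin m → Fin m → ℝ)
    (x : (Fin n → ℝ) → Fin m → ℝ) (θ : (Fin n → ℝ) → Fin n → Fin n → ℝ)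
    (γ2 : (Fin n → ℝ) → ℝ) (p : Fin n → ℝ) (i k : Fin m) : ℝ :=
  Dop η x θ γ2 (fun q => x q k) p i

/-- `Π^{ij} = η^{ij} − D^{ij}`, the projection onto the normal space. -/
noncomputable def PiU (η ηi : (Fin m → ℝ) → Fin m → Fin m → ℝ)
    (x : (Fin n → ℝ) → Fin m → ℝ) (θ : (Fin n → ℝ) → Fin n → Fin n → ℝ)
    (γ2 : (Fin n → ℝ) → ℝ) (p : Fin n → ℝ) (i j : Fin m) : ℝ :=
  ηi (x p) i j - Dmat η x θ γ2 p i j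

/-- The lowered projection `Π_{ij} = η_{ij} − D_{ij}`. -/
noncomputable def PiL (η : (Fin m → ℝ) → Fin m → Fin m → ℝ)
    (x : (Fin n → ℝ) → Fin m → ℝ) (θ : (Fin n → ℝ) → Fin n → Fin n → ℝ)
    (γ2 : (Fin n → ℝ) → ℝ) (p : Fin n → ℝ) (i j : Fin m) : ℝ :=
  η (x p) i j - ∑ k, ∑ l, η (x p) i k * η (x p) j l * Dmat η x θ γ2 p k l

/-- The ambient components `X^i = c^a ∂_a x^i` of the tangent field with coefficient
functions `c`. -/
noncomputable def tv (x : (Fin n → ℝ) → Fin m → ℝ) (c : (Fin n → ℝ) → Fin n → ℝ)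
    (p : Fin n → ℝ) (i : Fin m) : ℝ :=
  ∑ a, c p a * pd a (fun q => x q i) p

/-- Lowering an ambient index along `Σ` : `V_i = η_{ij} V^j`. -/
noncomputable def low (η : (Fin m → ℝ) → Fin m → Fin m → ℝ)
    (x : (Fin n → ℝ) → Fin m → ℝ) (V : (Fin n → ℝ) → Fin m → ℝ)
    (p : Fin n → ℝ) (i : Fin m) : ℝ :=
  ∑ j, η (x p) i j * V p j

/-- The ambient inner product `η(V,W)` along `Σ`. -/
noncomputable def ipM (η : (Fin m → ℝ) → Fin m → Fin m → ℝ)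
    (x : (Fin n → ℝ) → Fin m → ℝ) (V W : (Fin n → ℝ) → Fin m → ℝ)
    (p : Fin n → ℝ) : ℝ :=
  ∑ i, ∑ j, η (x p) i j * V p i * W p j

/-- The ambient covariant derivative `(∇̄_{e_a} V)^i` of an ambient-vector field `V`
along `Σ`. -/
noncomputable def barD (η ηi : (Fin m → ℝ) → Fin m → Fin m → ℝ)
    (x : (Fin n → ℝ) → Fin m → ℝ) (V : (Fin n → ℝ) → Fin m → ℝ)
    (p : Fin n → ℝ) (a : Fin n) (i : Fin m) : ℝ :=
  pd a (fun q => V q i) p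
    + ∑ k, ∑ l, Chr η ηi (x p) i k l * pd a (fun q => x q k) p * V p l

/-- `∇̂^i u = D^i(u)` on scalars. -/
noncomputable def nhS (η : (Fin m → ℝ) → Fin m → Fin m → ℝ)
    (x : (Fin n → ℝ) → Fin m → ℝ) (θ : (Fin n → ℝ) → Fin n → Fin n → ℝ)
    (γ2 : (Fin n → ℝ) → ℝ) (u : (Fin n → ℝ) → ℝ) (p : Fin n → ℝ) (i : Fin m) : ℝ :=
  Dop η x θ γ2 u p i

/-- `∇̂^i V^j = D^i(V^j) + D^{ik} Γ̄^j_{kl} V^l` for ambient-vector fields `V` along `Σ`. -/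
noncomputable def nhV (η ηi : (Fin m → ℝ) → Fin m → Fin m → ℝ)
    (x : (Fin n → ℝ) → Fin m → ℝ) (θ : (Fin n → ℝ) → Fin n → Fin n → ℝ)
    (γ2 : (Fin n → ℝ) → ℝ) (V : (Fin n → ℝ) → Fin m → ℝ)
    (p : Fin n → ℝ) (i j : Fin m) : ℝ :=
  Dop η x θ γ2 (fun q => V q j) p i
    + ∑ k, ∑ l, Dmat η x θ γ2 p i k * Chr η ηi (x p) j k l * V p l

/-- `∇̂^i T^{jk}` for `2`-contravariant tensor fields `T` along `Σ`. -/
noncomputable def nhT2 (η ηi : (Fin m → ℝ) → Fin m → Fin m → ℝ)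
    (x : (Fin n → ℝ) → Fin m → ℝ) (θ : (Fin n → ℝ) → Fin n → Fin n → ℝ)
    (γ2 : (Fin n → ℝ) → ℝ) (T : (Fin n → ℝ) → Fin m → Fin m → ℝ)
    (p : Fin n → ℝ) (i j k : Fin m) : ℝ :=
  Dop η x θ γ2 (fun q => T q j k) p i
    + ∑ l, ∑ l', Dmat η x θ γ2 p i l * Chr η ηi (x p) j l l' * T p l' k
    + ∑ l, ∑ l', Dmat η x θ γ2 p i l * Chr η ηi (x p) k l l' * T p j l'

/-- `∇̂^i T_{jk}` for `2`-covariant tensor fields `T` along `Σ`. -/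
noncomputable def nhT02 (η ηi : (Fin m → ℝ) → Fin m → Fin m → ℝ)
    (x : (Fin n → ℝ) → Fin m → ℝ) (θ : (Fin n → ℝ) → Fin n → Fin n → ℝ)
    (γ2 : (Fin n → ℝ) → ℝ) (T : (Fin n → ℝ) → Fin m → Fin m → ℝ)
    (p : Fin n → ℝ) (i j k : Fin m) : ℝ :=
  Dop η x θ γ2 (fun q => T q j k) p i
    - ∑ l, ∑ l', Dmat η x θ γ2 p i l * Chr η ηi (x p) l' l j * T p l' k
    - ∑ l, ∑ l', Dmat η x θ γ2 p i l * Chr η ηi (x p) l' l k * T p j l'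

/-- The second fundamental form `α(X,Y) = Π(∇̂_X Y)` (ambient components) for tangent
fields with coefficients `c`, `d`. -/
noncomputable def sff (η ηi : (Fin m → ℝ) → Fin m → Fin m → ℝ)
    (x : (Fin n → ℝ) → Fin m → ℝ) (θ : (Fin n → ℝ) → Fin n → Fin n → ℝ)
    (γ2 : (Fin n → ℝ) → ℝ) (c d : (Fin n → ℝ) → Fin n → ℝ)
    (p : Fin n → ℝ) (i : Fin m) : ℝ :=
  ∑ j, ((if i = j then (1:ℝ) else 0) - ∑ k, Dmat η x θ γ2 p i k * η (x p) k j)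
    * (∑ a, c p a * barD η ηi x (tv x d) p a j)

/-- `B_A^{ij} = −γ² ∇̂^i N_A^j`. -/
noncomputable def Bmap (η ηi : (Fin m → ℝ) → Fin m → Fin m → ℝ)
    (x : (Fin n → ℝ) → Fin m → ℝ) (θ : (Fin n → ℝ) → Fin n → Fin n → ℝ)
    (γ2 : (Fin n → ℝ) → ℝ) (N : (Fin n → ℝ) → Fin m → ℝ)
    (p : Fin n → ℝ) (i j : Fin m) : ℝ :=
  - γ2 p * nhV η ηi x θ γ2 N p i j

/-- `N` is a smooth orthonormal frame of the normal bundle `TΣ^⊥` :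
each `N_A` is a smooth unit normal field, they are mutually orthonormal, and they
are complete, i.e. `Σ_A N_A^i N_A^j = η^{ij} − D^{ij} = Π^{ij}`. -/
def NormalFrame {r : ℕ} (η ηi : (Fin m → ℝ) → Fin m → Fin m → ℝ)
    (x : (Fin n → ℝ) → Fin m → ℝ) (θ : (Fin n → ℝ) → Fin n → Fin n → ℝ)
    (γ2 : (Fin n → ℝ) → ℝ) (N : Fin r → (Fin n → ℝ) → Fin m → ℝ) : Prop :=
  (∀ A i, ContDiff ℝ (⊤ : ℕ∞) fun q => N A q i) ∧
  (∀ A B p, ipM η x (N A) (N B) p = if A = B then (1:ℝ) else 0) ∧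
  (∀ A p a, (∑ i, ∑ j, η (x p) i j * N A p i * pd a (fun q => x q j) p) = 0) ∧
  (∀ p i j, (∑ A, N A p i * N A p j) = PiU η ηi x θ γ2 p i j)



/-! ### Calculus helpers -/

lemma pd_add' {k : ℕ} (a : Fin k) {f g : (Fin k → ℝ) → ℝ} (p : Fin k → ℝ)
    (hf : DifferentiableAt ℝ f p) (hg : DifferentiableAt ℝ g p) :
    pd a (fun q => f q + g q) p = pd a f p + pd a g p := by
  unfold pd
  rw [fderiv_fun_add hf hg]; simp

lemma pd_mul' {k : ℕ} (a : Fin k) {f g : (Fin k → ℝ) → ℝ} (p : Fin k → ℝ)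
    (hf : DifferentiableAt ℝ f p) (hg : DifferentiableAt ℝ g p) :
    pd a (fun q => f q * g q) p = pd a f p * g p + f p * pd a g p := by
  unfold pd
  rw [fderiv_fun_mul hf hg]; simp; ring

lemma pd_sum' {k : ℕ} {ι : Type*} [Fintype ι] (a : Fin k) {f : ι → (Fin k → ℝ) → ℝ}
    (p : Fin k → ℝ) (hf : ∀ i, DifferentiableAt ℝ (f i) p) :
    pd a (fun q => ∑ i, f i q) p = ∑ i, pd a (f i) p := by
  unfold pd
  rw [fderiv_fun_sum (fun i _ => hf i)]; simp

lemma pd_const' {k : ℕ} (a : Fin k) (c : ℝ) (p : Fin k → ℝ) :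
    pd a (fun _ => c) p = 0 := by
  unfold pd; simp

lemma pd_smooth {k : ℕ} (a : Fin k) {f : (Fin k → ℝ) → ℝ} (hf : ContDiff ℝ (⊤ : ℕ∞) f) :
    ContDiff ℝ (⊤ : ℕ∞) (fun q => pd a f q) := by
  unfold pd
  exact (hf.fderiv_right (m := (⊤ : ℕ∞)) (by simp)).clm_apply contDiff_const

lemma pd_comm {k : ℕ} (a b : Fin k) {f : (Fin k → ℝ) → ℝ} (hf : ContDiff ℝ (⊤ : ℕ∞) f)
    (p : Fin k → ℝ) :
    pd a (fun q => pd b f q) p = pd b (fun q => pd a f q) p := by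
  have h1 : ContDiff ℝ (⊤ : ℕ∞) (fderiv ℝ f) := hf.fderiv_right (m := (⊤ : ℕ∞)) (by simp)
  have h2 : DifferentiableAt ℝ (fderiv ℝ f) p := h1.differentiable (by simp) p
  have hs : IsSymmSndFDerivAt ℝ f p := by
    apply (hf.contDiffAt).isSymmSndFDerivAt
    simp only [minSmoothness_of_isRCLikeNormedField]
    exact WithTop.coe_le_coe.2 (le_top : (2 : ℕ∞) ≤ ⊤)
  unfold pd
  rw [fderiv_clm_apply h2 (differentiableAt_const _),
    fderiv_clm_apply h2 (differentiableAt_const _)]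
  simpa using hs (Pi.single a 1) (Pi.single b 1)

lemma sm_diff {k : ℕ} {f : (Fin k → ℝ) → ℝ} (hf : ContDiff ℝ (⊤ : ℕ∞) f) (p : Fin k → ℝ) :
    DifferentiableAt ℝ f p := hf.differentiable (by simp) p

lemma emb_smooth {x : (Fin n → ℝ) → Fin m → ℝ} (hx : SmoothEmb x) :
    ContDiff ℝ (⊤ : ℕ∞) x := contDiff_pi.2 hx

lemma pd_chain {x : (Fin n → ℝ) → Fin m → ℝ} (hx : SmoothEmb x) {f : (Fin m → ℝ) → ℝ}
    (hf : ContDiff ℝ (⊤ : ℕ∞) f) (a : Fin n) (p : Fin n → ℝ) :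
    pd a (fun q => f (x q)) p = ∑ k, pd k f (x p) * pd a (fun q => x q k) p := by
  have hxd : DifferentiableAt ℝ x p := (emb_smooth hx).differentiable (by simp) p
  unfold pd
  have := fderiv_comp (𝕜 := ℝ) p (sm_diff hf (x p)) hxd
  simp only [Function.comp_def] at this
  rw [this]
  have h3 : ∀ k, fderiv ℝ (fun q => x q k) p (Pi.single a 1) = fderiv ℝ x p (Pi.single a 1) k := by
    intro k
    rw [fderiv_apply hxd]
    rfl
  simp only [h3]
  change fderiv ℝ f (x p) (fderiv ℝ x p (Pi.single a 1)) = _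
  generalize fderiv ℝ x p (Pi.single a 1) = v
  conv_lhs => rw [← Finset.univ_sum_single v]
  rw [map_sum]
  refine Finset.sum_congr rfl fun k _ => ?_
  have : (Pi.single k (v k) : Fin m → ℝ) = v k • Pi.single k (1:ℝ) := by
    rw [← Pi.single_smul]; simp
  rw [this, map_smul, smul_eq_mul, mul_comm]

/-! ### Metric algebra -/

lemma inv_left {k : ℕ} {g gi : Fin k → Fin k → ℝ}
    (h : ∀ i j, (∑ l, g i l * gi l j) = if i = j then (1:ℝ) else 0) :
    ∀ i j, (∑ l, gi i l * g l j) = if i = j then (1:ℝ) else 0 := by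
  have h1 : (Matrix.of g) * (Matrix.of gi) = 1 := by
    ext i j; simp [Matrix.mul_apply, h, Matrix.one_apply]
  have h2 := mul_eq_one_comm.1 h1
  intro i j
  have := congrFun (congrFun h2 i) j
  simpa [Matrix.mul_apply, Matrix.one_apply] using this

lemma inv_symm {k : ℕ} {g gi : Fin k → Fin k → ℝ} (hs : ∀ i j, g i j = g j i)
    (h : ∀ i j, (∑ l, g i l * gi l j) = if i = j then (1:ℝ) else 0) :
    ∀ i j, gi i j = gi j i := by
  have h1 : (Matrix.of g) * (Matrix.of gi) = 1 := by
    ext i j; simp [Matrix.mul_apply, h, Matrix.one_apply]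
  have h2 := mul_eq_one_comm.1 h1
  have hT : (Matrix.of g).transpose = Matrix.of g := by
    ext i j; simp [hs j i]
  have h3 : (Matrix.of gi).transpose = Matrix.of gi := by
    have h4 := congrArg Matrix.transpose h1
    rw [Matrix.transpose_mul, hT, Matrix.transpose_one] at h4
    exact left_inv_eq_right_inv h4 h1
  intro i j
  exact congrFun (congrFun h3 j) i

lemma det_smooth {k l : ℕ} (A : (Fin k → ℝ) → Matrix (Fin l) (Fin l) ℝ)
    (hA : ∀ i j, ContDiff ℝ (⊤ : ℕ∞) fun q => A q i j) :
    ContDiff ℝ (⊤ : ℕ∞) fun q => (A q).det := by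
  simp only [Matrix.det_apply']
  refine ContDiff.sum fun σ _ => contDiff_const.mul (contDiff_prod fun i _ => hA _ _)

lemma inv_smooth {k : ℕ} {g gi : (Fin k → ℝ) → Fin k → Fin k → ℝ} (hg : Smooth2 g)
    (h : ∀ q i j, (∑ l, g q i l * gi q l j) = if i = j then (1:ℝ) else 0) :
    Smooth2 gi := by
  have h1 : ∀ q, (Matrix.of (g q)) * (Matrix.of (gi q)) = 1 := by
    intro q
    ext i j; simp [Matrix.mul_apply, h, Matrix.one_apply]
  have hdet : ∀ q, (Matrix.of (g q)).det ≠ 0 := fun q =>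
    (Matrix.isUnit_det_of_right_inverse (h1 q)).ne_zero
  intro i j
  have h2 : (fun q => gi q i j) = fun q => ((Matrix.of (g q)).det)⁻¹ *
      ((Matrix.of (g q)).adjugate i j) := by
    funext q
    have h3 : (Matrix.of (g q))⁻¹ = Matrix.of (gi q) := Matrix.inv_eq_right_inv (h1 q)
    have h4 := congrFun (congrFun h3 i) j
    rw [Matrix.inv_def] at h4
    simpa using h4.symm
  rw [h2]
  refine ContDiff.mul (ContDiff.inv (det_smooth _ fun i j => hg i j) hdet) ?_
  simp only [Matrix.adjugate_apply]
  refine det_smooth _ fun a b => ?_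
  by_cases hab : a = j
  · subst hab
    simp only [Matrix.updateRow_self]
    exact contDiff_const
  · simp only [Matrix.updateRow_ne hab]
    exact hg a b

lemma lowChr {k : ℕ} {g gi : (Fin k → ℝ) → Fin k → Fin k → ℝ} (q : Fin k → ℝ)
    (h : ∀ i j, (∑ l, g q i l * gi q l j) = if i = j then (1:ℝ) else 0) (i b c : Fin k) :
    ∑ s, g q i s * Chr g gi q s b c = (1/2) *
      (pd b (fun r => g r i c) q + pd c (fun r => g r i b) q - pd i (fun r => g r b c) q) := by
  unfold Chr
  simp only [Finset.mul_sum]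
  rw [Finset.sum_comm]
  have : ∀ d, ∑ s, g q i s * (1 / 2 * (gi q s d *
      (pd b (fun r => g r d c) q + pd c (fun r => g r d b) q - pd d (fun r => g r b c) q)))
      = (∑ s, g q i s * gi q s d) * (1/2 * (pd b (fun r => g r d c) q
        + pd c (fun r => g r d b) q - pd d (fun r => g r b c) q)) := by
    intro d
    rw [Finset.sum_mul]
    exact Finset.sum_congr rfl fun s _ => by ring
  simp only [this, h]
  simp

lemma Chr_symm {k : ℕ} {g gi : (Fin k → ℝ) → Fin k → Fin k → ℝ} 
    (hs : ∀ q i j, g q i j = g q j i) (q : Fin k → ℝ) (a b c : Fin k) :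
    Chr g gi q a b c = Chr g gi q a c b := by
  unfold Chr
  congr 1
  refine Finset.sum_congr rfl fun d _ => ?_
  have : (fun r => g r b c) = fun r => g r c b := by funext r; exact hs r b c
  rw [this]; ring

lemma compat {k : ℕ} {g gi : (Fin k → ℝ) → Fin k → Fin k → ℝ}
    (hs : ∀ q i j, g q i j = g q j i) (q : Fin k → ℝ)
    (h : ∀ i j, (∑ l, g q i l * gi q l j) = if i = j then (1:ℝ) else 0) (c i j : Fin k) :
    pd c (fun r => g r i j) q = ∑ s, g q s j * Chr g gi q s c i
      + ∑ s, g q i s * Chr g gi q s c j := by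
  simp only [hs q _ j]
  rw [lowChr q h, lowChr q h]
  have e1 : ∀ a b, (fun r => g r a b) = fun r => g r b a := by
    intro a b; funext r; exact hs r a b
  rw [e1 j i, e1 j c, e1 i c]
  ring

lemma Chr_smooth {k : ℕ} {g gi : (Fin k → ℝ) → Fin k → Fin k → ℝ} (hg : Smooth2 g)
    (hgi : Smooth2 gi) (a b c : Fin k) : ContDiff ℝ (⊤ : ℕ∞) fun q => Chr g gi q a b c := by
  unfold Chr
  refine contDiff_const.mul (ContDiff.sum fun d _ => (hgi a d).mul ?_)
  exact ((pd_smooth b (hg d c)).add (pd_smooth c (hg d b))).sub (pd_smooth d (hg b c))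

/-! ### Sum reordering -/

section sums
variable {ι₁ ι₂ ι₃ ι₄ : Type*} [Fintype ι₁] [Fintype ι₂] [Fintype ι₃] [Fintype ι₄]

lemma s3_13 (F : ι₁ → ι₂ → ι₃ → ℝ) :
    ∑ i, ∑ j, ∑ k, F i j k = ∑ k, ∑ j, ∑ i, F i j k := by
  rw [Finset.sum_comm]
  rw [Finset.sum_congr rfl fun j _ => Finset.sum_comm]
  rw [Finset.sum_comm]

lemma s3_23 (F : ι₁ → ι₂ → ι₃ → ℝ) :
    ∑ i, ∑ j, ∑ k, F i j k = ∑ i, ∑ k, ∑ j, F i j k :=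
  Finset.sum_congr rfl fun _ _ => Finset.sum_comm

lemma s4_14 (F : ι₁ → ι₂ → ι₃ → ι₄ → ℝ) :
    ∑ i, ∑ j, ∑ k, ∑ l, F i j k l = ∑ l, ∑ j, ∑ k, ∑ i, F i j k l := by
  rw [Finset.sum_comm]
  rw [Finset.sum_congr rfl fun j _ => s3_13 _]
  rw [Finset.sum_comm]

lemma s4_24 (F : ι₁ → ι₂ → ι₃ → ι₄ → ℝ) :
    ∑ i, ∑ j, ∑ k, ∑ l, F i j k l = ∑ i, ∑ l, ∑ k, ∑ j, F i j k l :=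
  Finset.sum_congr rfl fun _ _ => s3_13 _

lemma s4_34 (F : ι₁ → ι₂ → ι₃ → ι₄ → ℝ) :
    ∑ i, ∑ j, ∑ k, ∑ l, F i j k l = ∑ i, ∑ j, ∑ l, ∑ k, F i j k l :=
  Finset.sum_congr rfl fun _ _ => s3_23 _

lemma s4_13 (F : ι₁ → ι₂ → ι₃ → ι₄ → ℝ) :
    ∑ i, ∑ j, ∑ k, ∑ l, F i j k l = ∑ k, ∑ j, ∑ i, ∑ l, F i j k l :=
  s3_13 _

lemma s4_23 (F : ι₁ → ι₂ → ι₃ → ι₄ → ℝ) :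
    ∑ i, ∑ j, ∑ k, ∑ l, F i j k l = ∑ i, ∑ k, ∑ j, ∑ l, F i j k l :=
  s3_23 _

end sums

lemma alg_compat (H : Fin m → Fin m → ℝ) (G : Fin m → Fin m → Fin m → ℝ) (E V W : Fin m → ℝ) :
    ∑ i, ∑ j, (∑ k, (∑ s, H s j * G s k i + ∑ s, H i s * G s k j) * E k) * V i * W j
    = ∑ i, ∑ j, H i j * (∑ k, ∑ l, G i k l * E k * V l) * W j
      + ∑ i, ∑ j, H i j * V i * (∑ k, ∑ l, G j k l * E k * W l) := by
  simp only [add_mul, Finset.sum_add_distrib, Finset.sum_mul, Finset.mul_sum]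
  congr 1
  · rw [s4_14]
    refine Finset.sum_congr rfl fun _ _ => Finset.sum_congr rfl fun _ _ =>
      Finset.sum_congr rfl fun _ _ => Finset.sum_congr rfl fun _ _ => by ring
  · rw [s4_24]
    refine Finset.sum_congr rfl fun _ _ => Finset.sum_congr rfl fun _ _ =>
      Finset.sum_congr rfl fun _ _ => Finset.sum_congr rfl fun _ _ => by ring

lemma compatAlong {η ηi : (Fin m → ℝ) → Fin m → Fin m → ℝ} {x : (Fin n → ℝ) → Fin m → ℝ}
    (hη : IsMetric η ηi) (hx : SmoothEmb x) {V W : (Fin n → ℝ) → Fin m → ℝ}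
    (hV : ∀ i, ContDiff ℝ (⊤ : ℕ∞) fun q => V q i)
    (hW : ∀ i, ContDiff ℝ (⊤ : ℕ∞) fun q => W q i) (a : Fin n) (p : Fin n → ℝ) :
    pd a (fun q => ipM η x V W q) p
      = ipM η x (fun q i => barD η ηi x V q a i) W p
        + ipM η x V (fun q i => barD η ηi x W q a i) p := by
  obtain ⟨hs, hsym, -, hinv⟩ := hη
  have hηx : ∀ i j, ContDiff ℝ (⊤ : ℕ∞) fun q => η (x q) i j := fun i j =>
    (hs i j).comp (emb_smooth hx)
  have hT : ∀ i j, ContDiff ℝ (⊤ : ℕ∞) fun q => η (x q) i j * V q i * W q j := fun i j =>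
    ((hηx i j).mul (hV i)).mul (hW j)
  have key := alg_compat (η (x p)) (Chr η ηi (x p)) (fun k => pd a (fun q => x q k) p)
    (V p) (W p)
  have h1 : pd a (fun q => ipM η x V W q) p = ∑ i, ∑ j,
      ((∑ k, (∑ s, η (x p) s j * Chr η ηi (x p) s k i + ∑ s, η (x p) i s * Chr η ηi (x p) s k j)
        * pd a (fun q => x q k) p) * V p i * W p j
      + η (x p) i j * pd a (fun q => V q i) p * W p j
      + η (x p) i j * V p i * pd a (fun q => W q j) p) := by
    unfold ipM
    rw [pd_sum' a p (fun i => sm_diff (ContDiff.sum fun j _ => hT i j) p)]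
    refine Finset.sum_congr rfl fun i _ => ?_
    rw [pd_sum' a p (fun j => sm_diff (hT i j) p)]
    refine Finset.sum_congr rfl fun j _ => ?_
    rw [pd_mul' a p (sm_diff ((hηx i j).mul (hV i)) p) (sm_diff (hW j) p),
      pd_mul' a p (sm_diff (hηx i j) p) (sm_diff (hV i) p),
      pd_chain hx (hs i j)]
    simp only [compat hsym (x p) (hinv (x p))]
    ring
  rw [h1]
  simp only [Finset.sum_add_distrib]
  rw [key]
  unfold ipM barD
  simp only [mul_add, add_mul, Finset.sum_add_distrib]
  ring

/-- `(∇̄_{e_a} e_b)^i`. -/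
noncomputable def Wf (η ηi : (Fin m → ℝ) → Fin m → Fin m → ℝ) (x : (Fin n → ℝ) → Fin m → ℝ)
    (a b : Fin n) (p : Fin n → ℝ) (i : Fin m) : ℝ :=
  barD η ηi x (fun q j => pd b (fun q' => x q' j) q) p a i

lemma Wf_symm {η ηi : (Fin m → ℝ) → Fin m → Fin m → ℝ} {x : (Fin n → ℝ) → Fin m → ℝ}
    (hη : IsMetric η ηi) (hx : SmoothEmb x) (a b : Fin n) :
    Wf η ηi x a b = Wf η ηi x b a := by
  funext p i
  unfold Wf barD
  rw [pd_comm a b (hx i)]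
  congr 1
  rw [Finset.sum_comm]
  refine Finset.sum_congr rfl fun k _ => Finset.sum_congr rfl fun l _ => ?_
  rw [Chr_symm hη.2.1]; ring

lemma Wf_smooth {η ηi : (Fin m → ℝ) → Fin m → Fin m → ℝ} {x : (Fin n → ℝ) → Fin m → ℝ}
    (hη : IsMetric η ηi) (hx : SmoothEmb x) (a b : Fin n) (i : Fin m) :
    ContDiff ℝ (⊤ : ℕ∞) fun q => Wf η ηi x a b q i := by
  unfold Wf barD
  have hi := inv_smooth hη.1 hη.2.2.2
  refine (pd_smooth a (pd_smooth b (hx i))).add (ContDiff.sum fun k _ => ContDiff.sum fun l _ => ?_)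
  exact (((Chr_smooth hη.1 hi i k l).comp (emb_smooth hx)).mul (pd_smooth a (hx k))).mul
    (pd_smooth b (hx l))

lemma ind_eq (η : (Fin m → ℝ) → Fin m → Fin m → ℝ) (x : (Fin n → ℝ) → Fin m → ℝ) (a b : Fin n)
    (p : Fin n → ℝ) : ind η x p a b = ipM η x (fun q j => pd a (fun q' => x q' j) q)
      (fun q j => pd b (fun q' => x q' j) q) p := rfl

lemma ipM_symm {η ηi : (Fin m → ℝ) → Fin m → Fin m → ℝ} {x : (Fin n → ℝ) → Fin m → ℝ}
    (hη : IsMetric η ηi) (V W : (Fin n → ℝ) → Fin m → ℝ) (p : Fin n → ℝ) :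
    ipM η x V W p = ipM η x W V p := by
  unfold ipM
  rw [Finset.sum_comm]
  refine Finset.sum_congr rfl fun k _ => Finset.sum_congr rfl fun l _ => ?_
  rw [hη.2.1 _ l k]; ring

lemma pd_ind {η ηi : (Fin m → ℝ) → Fin m → Fin m → ℝ} {x : (Fin n → ℝ) → Fin m → ℝ}
    (hη : IsMetric η ηi) (hx : SmoothEmb x) (a b c : Fin n) (p : Fin n → ℝ) :
    pd c (fun q => ind η x q a b) p
      = ipM η x (Wf η ηi x c a) (fun q j => pd b (fun q' => x q' j) q) p
        + ipM η x (Wf η ηi x c b) (fun q j => pd a (fun q' => x q' j) q) p := by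
  simp only [ind_eq]
  rw [compatAlong hη hx (fun i => pd_smooth a (hx i)) (fun i => pd_smooth b (hx i))]
  congr 1
  exact ipM_symm hη _ _ p

lemma ind_symm {η ηi : (Fin m → ℝ) → Fin m → Fin m → ℝ} {x : (Fin n → ℝ) → Fin m → ℝ}
    (hη : IsMetric η ηi) (p : Fin n → ℝ) (a b : Fin n) :
    ind η x p a b = ind η x p b a := by
  simp only [ind_eq]; exact ipM_symm hη _ _ p

lemma ind_smooth {η ηi : (Fin m → ℝ) → Fin m → Fin m → ℝ} {x : (Fin n → ℝ) → Fin m → ℝ}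
    (hη : IsMetric η ηi) (hx : SmoothEmb x) : Smooth2 (fun q => ind η x q) := by
  intro a b
  unfold ind
  exact ContDiff.sum fun i _ => ContDiff.sum fun j _ =>
    (((hη.1 i j).comp (emb_smooth hx)).mul (pd_smooth a (hx i))).mul (pd_smooth b (hx j))

lemma koszul {η ηi : (Fin m → ℝ) → Fin m → Fin m → ℝ} {x : (Fin n → ℝ) → Fin m → ℝ}
    {gi : (Fin n → ℝ) → Fin n → Fin n → ℝ}
    (hη : IsMetric η ηi) (hx : SmoothEmb x)
    (hg : ∀ p a b, (∑ c, ind η x p a c * gi p c b) = if a = b then (1:ℝ) else 0)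
    (a b c : Fin n) (p : Fin n → ℝ) :
    ∑ s, ind η x p c s * Chr (fun q => ind η x q) gi p s a b
      = ipM η x (Wf η ηi x a b) (fun q j => pd c (fun q' => x q' j) q) p := by
  rw [lowChr (g := fun q => ind η x q) p (hg p)]
  simp only [pd_ind hη hx]
  rw [Wf_symm hη hx b a, Wf_symm hη hx c a, Wf_symm hη hx c b]
  ring

/-- expanded second derivative -/
lemma barD_Wf {η ηi : (Fin m → ℝ) → Fin m → Fin m → ℝ} {x : (Fin n → ℝ) → Fin m → ℝ}
    (hη : IsMetric η ηi) (hx : SmoothEmb x) (b c d : Fin n) (p : Fin n → ℝ) (i : Fin m) :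
    barD η ηi x (Wf η ηi x d b) p c i
      = pd c (fun q => pd d (fun q => pd b (fun q => x q i) q) q) p
      + ∑ k, ∑ l, ((∑ s, pd s (fun r => Chr η ηi r i k l) (x p) * pd c (fun q => x q s) p)
          * pd d (fun q => x q k) p * pd b (fun q => x q l) p)
      + ∑ k, ∑ l, Chr η ηi (x p) i k l * pd c (fun q => pd d (fun q => x q k) q) p
          * pd b (fun q => x q l) p
      + ∑ k, ∑ l, Chr η ηi (x p) i k l * pd d (fun q => x q k) p
          * pd c (fun q => pd b (fun q => x q l) q) p
      + ∑ k, ∑ l, Chr η ηi (x p) i k l * pd c (fun q => x q k) p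
          * pd d (fun q => pd b (fun q => x q l) q) p
      + ∑ k, ∑ l, Chr η ηi (x p) i k l * pd c (fun q => x q k) p
          * ∑ u, ∑ v, Chr η ηi (x p) l u v * pd d (fun q => x q u) p * pd b (fun q => x q v) p := by
  have hi := inv_smooth hη.1 hη.2.2.2
  have hC : ∀ i k l, ContDiff ℝ (⊤ : ℕ∞) fun q => Chr η ηi (x q) i k l := fun i k l =>
    (Chr_smooth hη.1 hi i k l).comp (emb_smooth hx)
  have hT : ∀ k l, ContDiff ℝ (⊤ : ℕ∞) fun q => Chr η ηi (x q) i k l * pd d (fun q => x q k) q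
      * pd b (fun q => x q l) q := fun k l =>
    ((hC i k l).mul (pd_smooth d (hx k))).mul (pd_smooth b (hx l))
  have h1 : pd c (fun q => Wf η ηi x d b q i) p
      = pd c (fun q => pd d (fun q => pd b (fun q => x q i) q) q) p
      + ∑ k, ∑ l, ((∑ s, pd s (fun r => Chr η ηi r i k l) (x p) * pd c (fun q => x q s) p)
          * pd d (fun q => x q k) p * pd b (fun q => x q l) p
        + Chr η ηi (x p) i k l * pd c (fun q => pd d (fun q => x q k) q) p
          * pd b (fun q => x q l) p
        + Chr η ηi (x p) i k l * pd d (fun q => x q k) p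
          * pd c (fun q => pd b (fun q => x q l) q) p) := by
    unfold Wf barD
    rw [pd_add' c p (sm_diff (pd_smooth d (pd_smooth b (hx i))) p)
      (sm_diff (ContDiff.sum fun k _ => ContDiff.sum fun l _ => hT k l) p)]
    congr 1
    rw [pd_sum' c p (fun k => sm_diff (ContDiff.sum fun l _ => hT k l) p)]
    refine Finset.sum_congr rfl fun k _ => ?_
    rw [pd_sum' c p (fun l => sm_diff (hT k l) p)]
    refine Finset.sum_congr rfl fun l _ => ?_
    rw [pd_mul' c p (sm_diff ((hC i k l).mul (pd_smooth d (hx k))) p)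
        (sm_diff (pd_smooth b (hx l)) p),
      pd_mul' c p (sm_diff (hC i k l) p) (sm_diff (pd_smooth d (hx k)) p),
      pd_chain hx (Chr_smooth hη.1 hi i k l)]
    ring
  conv_lhs => unfold barD
  rw [h1]
  unfold Wf barD
  simp only [mul_add, Finset.sum_add_distrib]
  ring

lemma alg_curv (dG : Fin m → Fin m → Fin m → ℝ) (Gi : Fin m → Fin m → ℝ)
    (G : Fin m → Fin m → Fin m → ℝ) (B C D : Fin m → ℝ) :
    ∑ j, ∑ k, ∑ l, (dG k l j - dG l k j + ∑ e, (Gi k e * G e l j - Gi l e * G e k j))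
      * B j * C k * D l
    = (∑ k, ∑ l, ((∑ s, dG s k l * C s) * D k * B l)
      + ∑ k, ∑ l, Gi k l * C k * ∑ u, ∑ v, G l u v * D u * B v)
    - (∑ k, ∑ l, ((∑ s, dG s k l * D s) * C k * B l)
      + ∑ k, ∑ l, Gi k l * D k * ∑ u, ∑ v, G l u v * C u * B v) := by
  have e1 : ∀ C D : Fin m → ℝ, ∑ k, ∑ l, ((∑ s, dG s k l * C s) * D k * B l)
      = ∑ j, ∑ k, ∑ l, dG k l j * B j * C k * D l := by
    intro C D
    simp only [Finset.sum_mul]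
    rw [Finset.sum_comm, s3_23]
    refine Finset.sum_congr rfl fun _ _ => Finset.sum_congr rfl fun _ _ =>
      Finset.sum_congr rfl fun _ _ => by ring
  have e2 : ∀ C D : Fin m → ℝ, ∑ k, ∑ l, Gi k l * C k * ∑ u, ∑ v, G l u v * D u * B v
      = ∑ j, ∑ k, ∑ l, ∑ e, Gi k e * G e l j * B j * C k * D l := by
    intro C D
    simp only [Finset.mul_sum]
    rw [s4_24, s4_34, Finset.sum_comm]
    rw [s4_34]
    refine Finset.sum_congr rfl fun _ _ => Finset.sum_congr rfl fun _ _ =>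
      Finset.sum_congr rfl fun _ _ => Finset.sum_congr rfl fun _ _ => by ring
  rw [e1, e2, e1 D C, e2 D C]
  rw [s3_23 (fun j k l => dG k l j * B j * D k * C l),
    s4_23 (fun j k l e => Gi k e * G e l j * B j * D k * C l)]
  rw [← Finset.sum_add_distrib, ← Finset.sum_add_distrib, ← Finset.sum_sub_distrib]
  refine Finset.sum_congr rfl fun j _ => ?_
  rw [← Finset.sum_add_distrib, ← Finset.sum_add_distrib, ← Finset.sum_sub_distrib]
  refine Finset.sum_congr rfl fun k _ => ?_
  rw [← Finset.sum_add_distrib, ← Finset.sum_add_distrib, ← Finset.sum_sub_distrib]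
  refine Finset.sum_congr rfl fun l _ => ?_
  rw [Finset.sum_sub_distrib]
  simp only [add_mul, sub_mul, Finset.sum_mul]
  simp only [mul_right_comm _ (D l) (C k)]
  ring

lemma curv {η ηi : (Fin m → ℝ) → Fin m → Fin m → ℝ} {x : (Fin n → ℝ) → Fin m → ℝ}
    (hη : IsMetric η ηi) (hx : SmoothEmb x) (b c d : Fin n) (p : Fin n → ℝ) (i : Fin m) :
    barD η ηi x (Wf η ηi x d b) p c i - barD η ηi x (Wf η ηi x c b) p d i
      = ∑ j, ∑ k, ∑ l, Riem η ηi (x p) i j k l * pd b (fun q => x q j) p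
        * pd c (fun q => x q k) p * pd d (fun q => x q l) p := by
  rw [barD_Wf hη hx, barD_Wf hη hx]
  unfold Riem
  have key := alg_curv (fun s k l => pd s (fun r => Chr η ηi r i k l) (x p))
    (fun k l => Chr η ηi (x p) i k l) (Chr η ηi (x p)) (fun j => pd b (fun q => x q j) p)
    (fun j => pd c (fun q => x q j) p) (fun j => pd d (fun q => x q j) p)
  rw [key]
  rw [pd_comm c d (pd_smooth b (hx i))]
  simp only [fun k => pd_comm c d (hx k)]
  ring

/-! ### The Kähler–Poisson operators -/

lemma quad {ι κ ι' κ' : Type*} [Fintype ι] [Fintype κ] [Fintype ι'] [Fintype κ']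
    (u : ι → ℝ) (v : ι' → ℝ) (E : ι → κ → ℝ) (F : ι' → κ' → ℝ) (H : κ → κ' → ℝ) :
    ∑ k, ∑ l, (∑ b, u b * E b k) * (∑ d, v d * F d l) * H k l
      = ∑ b, ∑ d, u b * v d * ∑ k, ∑ l, E b k * F d l * H k l := by
  simp only [Finset.sum_mul, Finset.mul_sum]
  rw [s4_34, s4_13, s4_24]
  refine Finset.sum_congr rfl fun _ _ => Finset.sum_congr rfl fun _ _ => ?_
  refine Finset.sum_congr rfl fun _ _ => Finset.sum_congr rfl fun _ _ => by ring

lemma Dop_eq {η : (Fin m → ℝ) → Fin m → Fin m → ℝ} {x : (Fin n → ℝ) → Fin m → ℝ}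
    {θ : (Fin n → ℝ) → Fin n → Fin n → ℝ} {γ2 : (Fin n → ℝ) → ℝ}
    {gi : (Fin n → ℝ) → Fin n → Fin n → ℝ} (hakp : IsAKP η x θ γ2 gi)
    (u : (Fin n → ℝ) → ℝ) (p : Fin n → ℝ) (i : Fin m) :
    Dop η x θ γ2 u p i = ∑ a, ∑ c, gi p a c * pd c (fun q => x q i) p * pd a u p := by
  obtain ⟨-, -, -, -, -, hpos, -, hθ⟩ := hakp
  have h1 : ∀ (f : (Fin n → ℝ) → ℝ) k, pbr θ f (fun q => x q k) p
      = ∑ b, (∑ a, pd a f p * θ p a b) * pd b (fun q => x q k) p := by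
    intro f k
    unfold pbr
    rw [Finset.sum_comm]
    refine Finset.sum_congr rfl fun b _ => ?_
    rw [Finset.sum_mul]
    refine Finset.sum_congr rfl fun a _ => by ring
  unfold Dop
  simp only [h1]
  rw [quad (fun b => ∑ a, pd a u p * θ p a b) (fun b => ∑ a, pd a (fun q => x q i) p * θ p a b)
    (fun b k => pd b (fun q => x q k) p) (fun b k => pd b (fun q => x q k) p) (η (x p))]
  have h2 : ∀ b d, ∑ k, ∑ l, pd b (fun q => x q k) p * pd d (fun q => x q l) p * η (x p) k l
      = ind η x p b d := by
    intro b d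
    unfold ind
    refine Finset.sum_congr rfl fun _ _ => Finset.sum_congr rfl fun _ _ => by ring
  simp only [h2]
  rw [quad (fun a => pd a u p) (fun a => pd a (fun q => x q i) p) (θ p) (θ p) (ind η x p)]
  simp only [← hθ, Finset.mul_sum]
  have := (hpos p).ne'
  refine Finset.sum_congr rfl fun _ _ => Finset.sum_congr rfl fun _ _ => by field_simp

lemma Dmat_eq {η : (Fin m → ℝ) → Fin m → Fin m → ℝ} {x : (Fin n → ℝ) → Fin m → ℝ}
    {θ : (Fin n → ℝ) → Fin n → Fin n → ℝ} {γ2 : (Fin n → ℝ) → ℝ}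
    {gi : (Fin n → ℝ) → Fin n → Fin n → ℝ} (hakp : IsAKP η x θ γ2 gi)
    (p : Fin n → ℝ) (i k : Fin m) :
    Dmat η x θ γ2 p i k = ∑ a, ∑ c, gi p a c * pd c (fun q => x q i) p
      * pd a (fun q => x q k) p := Dop_eq hakp _ p i

/-- `D^{ik} Φ_k = g^{ac} (∂_c x^i) Φ(e_a)`. -/
lemma Dmat_contr {η : (Fin m → ℝ) → Fin m → Fin m → ℝ} {x : (Fin n → ℝ) → Fin m → ℝ}
    {θ : (Fin n → ℝ) → Fin n → Fin n → ℝ} {γ2 : (Fin n → ℝ) → ℝ}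
    {gi : (Fin n → ℝ) → Fin n → Fin n → ℝ} (hakp : IsAKP η x θ γ2 gi)
    (p : Fin n → ℝ) (i : Fin m) (G : Fin m → Fin m → ℝ) (T : Fin m → ℝ) :
    ∑ k, ∑ l, Dmat η x θ γ2 p i k * G k l * T l
      = ∑ a, ∑ c, gi p a c * pd c (fun q => x q i) p *
        ∑ k, ∑ l, G k l * pd a (fun q => x q k) p * T l := by
  simp only [Dmat_eq hakp, Finset.sum_mul, Finset.mul_sum]
  rw [s4_13, s4_24]
  refine Finset.sum_congr rfl fun _ _ => Finset.sum_congr rfl fun _ _ => ?_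
  refine Finset.sum_congr rfl fun _ _ => Finset.sum_congr rfl fun _ _ => by ring

lemma nhV_eq {η ηi : (Fin m → ℝ) → Fin m → Fin m → ℝ} {x : (Fin n → ℝ) → Fin m → ℝ}
    {θ : (Fin n → ℝ) → Fin n → Fin n → ℝ} {γ2 : (Fin n → ℝ) → ℝ}
    {gi : (Fin n → ℝ) → Fin n → Fin n → ℝ} (hakp : IsAKP η x θ γ2 gi)
    (V : (Fin n → ℝ) → Fin m → ℝ) (p : Fin n → ℝ) (i j : Fin m) :
    nhV η ηi x θ γ2 V p i j = ∑ a, ∑ c, gi p a c * pd c (fun q => x q i) p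
      * barD η ηi x V p a j := by
  unfold nhV barD
  rw [Dop_eq hakp, Dmat_contr hakp p i (fun k l => Chr η ηi (x p) j k l) (V p)]
  simp only [mul_add, Finset.sum_add_distrib]

/-- Covariant derivative of a covariant 2-tensor along `e_a`. -/
noncomputable def barD02 (η ηi : (Fin m → ℝ) → Fin m → Fin m → ℝ) (x : (Fin n → ℝ) → Fin m → ℝ)
    (T : (Fin n → ℝ) → Fin m → Fin m → ℝ) (p : Fin n → ℝ) (a : Fin n) (j k : Fin m) : ℝ :=
  pd a (fun q => T q j k) p
    - ∑ l, ∑ l', Chr η ηi (x p) l' l j * pd a (fun q => x q l) p * T p l' k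
    - ∑ l, ∑ l', Chr η ηi (x p) l' l k * pd a (fun q => x q l) p * T p j l'

lemma nhT02_eq {η ηi : (Fin m → ℝ) → Fin m → Fin m → ℝ} {x : (Fin n → ℝ) → Fin m → ℝ}
    {θ : (Fin n → ℝ) → Fin n → Fin n → ℝ} {γ2 : (Fin n → ℝ) → ℝ}
    {gi : (Fin n → ℝ) → Fin n → Fin n → ℝ} (hakp : IsAKP η x θ γ2 gi)
    (T : (Fin n → ℝ) → Fin m → Fin m → ℝ) (p : Fin n → ℝ) (i j k : Fin m) :
    nhT02 η ηi x θ γ2 T p i j k = ∑ a, ∑ c, gi p a c * pd c (fun q => x q i) p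
      * barD02 η ηi x T p a j k := by
  unfold nhT02 barD02
  rw [Dop_eq hakp, Dmat_contr hakp p i (fun l l' => Chr η ηi (x p) l' l j) (fun l' => T p l' k),
    Dmat_contr hakp p i (fun l l' => Chr η ηi (x p) l' l k) (fun l' => T p j l')]
  simp only [mul_sub, Finset.sum_sub_distrib]

lemma low_E {η : (Fin m → ℝ) → Fin m → Fin m → ℝ} {x : (Fin n → ℝ) → Fin m → ℝ}
    (e : (Fin n → ℝ) → Fin n → ℝ) (p : Fin n → ℝ) (c : Fin n) :
    ∑ i, low η x (tv x e) p i * pd c (fun q => x q i) p = ∑ a, ind η x p c a * e p a := by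
  unfold low tv ind
  simp only [Finset.sum_mul, Finset.mul_sum]
  rw [s3_13, Finset.sum_comm, Finset.sum_comm]
  refine Finset.sum_congr rfl fun _ _ => ?_
  rw [Finset.sum_comm]
  refine Finset.sum_congr rfl fun _ _ => Finset.sum_congr rfl fun _ _ => by ring

lemma contr {η : (Fin m → ℝ) → Fin m → Fin m → ℝ} {x : (Fin n → ℝ) → Fin m → ℝ}
    {θ : (Fin n → ℝ) → Fin n → Fin n → ℝ} {γ2 : (Fin n → ℝ) → ℝ}
    {gi : (Fin n → ℝ) → Fin n → Fin n → ℝ} (hakp : IsAKP η x θ γ2 gi)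
    (e : (Fin n → ℝ) → Fin n → ℝ) (p : Fin n → ℝ) (Φ : Fin n → ℝ) :
    ∑ i, low η x (tv x e) p i * (∑ a, ∑ c, gi p a c * pd c (fun q => x q i) p * Φ a)
      = ∑ a, e p a * Φ a := by
  have hg := inv_left (hakp.2.2.2.2.2.2.1 p)
  have h1 : ∑ i, low η x (tv x e) p i * (∑ a, ∑ c, gi p a c * pd c (fun q => x q i) p * Φ a)
      = ∑ a, (∑ c, gi p a c * (∑ i, low η x (tv x e) p i * pd c (fun q => x q i) p)) * Φ a := by
    simp only [Finset.sum_mul, Finset.mul_sum]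
    rw [Finset.sum_comm]
    refine Finset.sum_congr rfl fun _ _ => ?_
    rw [Finset.sum_comm]
    refine Finset.sum_congr rfl fun _ _ => Finset.sum_congr rfl fun _ _ => by ring
  rw [h1]
  refine Finset.sum_congr rfl fun a _ => ?_
  congr 1
  simp only [low_E, Finset.mul_sum]
  rw [Finset.sum_comm]
  simp only [← mul_assoc, ← Finset.sum_mul, hg]
  simp

/-! ### The normal frame -/

lemma ipM_low {η : (Fin m → ℝ) → Fin m → Fin m → ℝ} {x : (Fin n → ℝ) → Fin m → ℝ}
    (V W : (Fin n → ℝ) → Fin m → ℝ) (p : Fin n → ℝ) :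
    ipM η x V W p = ∑ i, V p i * low η x W p i := by
  unfold ipM low
  refine Finset.sum_congr rfl fun i _ => ?_
  rw [Finset.mul_sum]
  refine Finset.sum_congr rfl fun _ _ => by ring

lemma raise_low {η ηi : (Fin m → ℝ) → Fin m → Fin m → ℝ} {x : (Fin n → ℝ) → Fin m → ℝ}
    (hη : IsMetric η ηi) (V : (Fin n → ℝ) → Fin m → ℝ) (p : Fin n → ℝ) (i : Fin m) :
    ∑ k, ηi (x p) i k * low η x V p k = V p i := by
  unfold low
  simp only [Finset.mul_sum]
  rw [Finset.sum_comm]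
  simp only [← mul_assoc, ← Finset.sum_mul, inv_left (hη.2.2.2 (x p))]
  simp

lemma PiL_eq {r : ℕ} {η ηi : (Fin m → ℝ) → Fin m → Fin m → ℝ} {x : (Fin n → ℝ) → Fin m → ℝ}
    {θ : (Fin n → ℝ) → Fin n → Fin n → ℝ} {γ2 : (Fin n → ℝ) → ℝ}
    {N : Fin r → (Fin n → ℝ) → Fin m → ℝ}
    (hη : IsMetric η ηi) (hN : NormalFrame η ηi x θ γ2 N) (p : Fin n → ℝ) (i j : Fin m) :
    PiL η x θ γ2 p i j = ∑ A, low η x (N A) p i * low η x (N A) p j := by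
  have h1 : ∀ k l, Dmat η x θ γ2 p k l = ηi (x p) k l - ∑ A, N A p k * N A p l := by
    intro k l; rw [hN.2.2.2]; unfold PiU; ring
  have h2 : ∑ k, ∑ l, η (x p) i k * η (x p) j l * ηi (x p) k l = η (x p) i j := by
    rw [Finset.sum_comm]
    have : ∀ l, ∑ k, η (x p) i k * η (x p) j l * ηi (x p) k l
        = (∑ k, η (x p) i k * ηi (x p) k l) * η (x p) j l := by
      intro l; rw [Finset.sum_mul]; exact Finset.sum_congr rfl fun _ _ => by ring
    simp only [this, hη.2.2.2]
    simp [hη.2.1 _ j i]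
  have h3 : ∑ k, ∑ l, η (x p) i k * η (x p) j l * ∑ A, N A p k * N A p l
      = ∑ A, low η x (N A) p i * low η x (N A) p j := by
    unfold low
    simp only [Finset.sum_mul, Finset.mul_sum]
    rw [s3_13]
    refine Finset.sum_congr rfl fun _ _ => ?_
    refine Finset.sum_congr rfl fun _ _ => Finset.sum_congr rfl fun _ _ => by ring
  unfold PiL
  simp only [h1, mul_sub, Finset.sum_sub_distrib]
  rw [h2, h3]; ring

lemma normal_decomp {r : ℕ} {η ηi : (Fin m → ℝ) → Fin m → Fin m → ℝ}
    {x : (Fin n → ℝ) → Fin m → ℝ}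
    {θ : (Fin n → ℝ) → Fin n → Fin n → ℝ} {γ2 : (Fin n → ℝ) → ℝ}
    {gi : (Fin n → ℝ) → Fin n → Fin n → ℝ} {N : Fin r → (Fin n → ℝ) → Fin m → ℝ}
    (hη : IsMetric η ηi) (hakp : IsAKP η x θ γ2 gi)
    (hN : NormalFrame η ηi x θ γ2 N) (U V : (Fin n → ℝ) → Fin m → ℝ) (p : Fin n → ℝ) :
    ∑ A, ipM η x (N A) U p * ipM η x (N A) V p
      = ipM η x U V p - ∑ e, ipM η x U (fun q j => pd e (fun q' => x q' j) q) p
        * ∑ f, gi p e f * ipM η x V (fun q j => pd f (fun q' => x q' j) q) p := by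
  have h0 : ∑ A, ipM η x (N A) U p * ipM η x (N A) V p
      = ∑ i, ∑ k, (∑ A, N A p i * N A p k) * low η x U p i * low η x V p k := by
    simp only [ipM_low, Finset.sum_mul_sum]
    simp only [Finset.sum_mul]
    rw [Finset.sum_comm, s3_23]
    refine Finset.sum_congr rfl fun _ _ => ?_
    refine Finset.sum_congr rfl fun _ _ => Finset.sum_congr rfl fun _ _ => by ring
  have h1 : ∑ i, ∑ k, ηi (x p) i k * low η x U p i * low η x V p k = ipM η x U V p := by
    rw [ipM_symm hη, ipM_low]
    refine Finset.sum_congr rfl fun i _ => ?_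
    rw [← raise_low hη V p i, Finset.sum_mul]
    refine Finset.sum_congr rfl fun _ _ => by ring
  have h2 : ∑ i, ∑ k, Dmat η x θ γ2 p i k * low η x U p i * low η x V p k
      = ∑ e, ipM η x U (fun q j => pd e (fun q' => x q' j) q) p
        * ∑ f, gi p e f * ipM η x V (fun q j => pd f (fun q' => x q' j) q) p := by
    have hgs := inv_symm (fun a b => ind_symm (x := x) hη p a b) (hakp.2.2.2.2.2.2.1 p)
    have hUV : ∀ (U : (Fin n → ℝ) → Fin m → ℝ) (e : Fin n),
        ipM η x U (fun q j => pd e (fun q' => x q' j) q) p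
        = ∑ i, low η x U p i * pd e (fun q => x q i) p := by
      intro U e
      rw [ipM_symm hη, ipM_low]
      exact Finset.sum_congr rfl fun _ _ => by ring
    have hR : ∀ e, ipM η x U (fun q j => pd e (fun q' => x q' j) q) p
        * ∑ f, gi p e f * ipM η x V (fun q j => pd f (fun q' => x q' j) q) p
        = ∑ f, (∑ i, low η x U p i * pd e (fun q => x q i) p)
          * (∑ i, low η x V p i * pd f (fun q => x q i) p) * gi p e f := by
      intro e
      rw [Finset.mul_sum]
      refine Finset.sum_congr rfl fun f _ => ?_
      rw [hUV, hUV]; ring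
    simp only [hR]
    rw [quad (low η x U p) (low η x V p) (fun i e => pd e (fun q => x q i) p)
      (fun i e => pd e (fun q => x q i) p) (gi p)]
    refine Finset.sum_congr rfl fun i _ => Finset.sum_congr rfl fun k _ => ?_
    rw [Dmat_eq hakp, Finset.sum_comm]
    simp only [Finset.sum_mul, Finset.mul_sum]
    refine Finset.sum_congr rfl fun _ _ => Finset.sum_congr rfl fun _ _ => ?_
    rw [hgs]; ring
  rw [h0]
  simp only [hN.2.2.2, PiU, sub_mul, Finset.sum_sub_distrib]
  rw [h1, h2]

/-- The intrinsic half of Gauss' equation. -/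
lemma gauss_half {r : ℕ} {η ηi : (Fin m → ℝ) → Fin m → Fin m → ℝ}
    {x : (Fin n → ℝ) → Fin m → ℝ}
    {θ : (Fin n → ℝ) → Fin n → Fin n → ℝ} {γ2 : (Fin n → ℝ) → ℝ}
    {gi : (Fin n → ℝ) → Fin n → Fin n → ℝ} {N : Fin r → (Fin n → ℝ) → Fin m → ℝ}
    (hη : IsMetric η ηi) (hx : SmoothEmb x) (hakp : IsAKP η x θ γ2 gi)
    (hN : NormalFrame η ηi x θ γ2 N) (a b c d : Fin n) (p : Fin n → ℝ) :
    ∑ e, ind η x p a e * (pd c (fun q => Chr (fun q => ind η x q) gi q e d b) p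
      + ∑ f, Chr (fun q => ind η x q) gi p e c f * Chr (fun q => ind η x q) gi p f d b)
    = ipM η x (fun q i => barD η ηi x (Wf η ηi x d b) q c i)
        (fun q j => pd a (fun q' => x q' j) q) p
      + ∑ A, ipM η x (N A) (Wf η ηi x c a) p * ipM η x (N A) (Wf η ηi x d b) p := by
  have hg := hakp.2.2.2.2.2.2.1
  have hgs := ind_smooth hη hx
  have hCs : ∀ e, ContDiff ℝ (⊤ : ℕ∞) fun q => Chr (fun q => ind η x q) gi q e d b := fun e =>
    Chr_smooth hgs hakp.2.2.2.1 e d b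
  have h1 : pd c (fun q => ∑ e, ind η x q a e * Chr (fun q => ind η x q) gi q e d b) p
      = ∑ e, (pd c (fun q => ind η x q a e) p * Chr (fun q => ind η x q) gi p e d b
        + ind η x p a e * pd c (fun q => Chr (fun q => ind η x q) gi q e d b) p) := by
    rw [pd_sum' c p (fun e => sm_diff ((hgs a e).mul (hCs e)) p)]
    exact Finset.sum_congr rfl fun e _ => pd_mul' c p (sm_diff (hgs a e) p) (sm_diff (hCs e) p)
  have h2 : pd c (fun q => ∑ e, ind η x q a e * Chr (fun q => ind η x q) gi q e d b) p
      = ipM η x (fun q i => barD η ηi x (Wf η ηi x d b) q c i)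
        (fun q j => pd a (fun q' => x q' j) q) p
        + ipM η x (Wf η ηi x d b) (Wf η ηi x c a) p := by
    simp only [koszul hη hx hg]
    rw [compatAlong hη hx (Wf_smooth hη hx d b) (fun i => pd_smooth a (hx i))]
    rfl
  have h3 : ∑ e, pd c (fun q => ind η x q a e) p * Chr (fun q => ind η x q) gi p e d b
      = ∑ e, ipM η x (Wf η ηi x c a) (fun q j => pd e (fun q' => x q' j) q) p
          * Chr (fun q => ind η x q) gi p e d b
        + ∑ e, ind η x p a e * ∑ f, Chr (fun q => ind η x q) gi p e c f
          * Chr (fun q => ind η x q) gi p f d b := by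
    simp only [pd_ind hη hx, add_mul, Finset.sum_add_distrib]
    congr 1
    simp only [← koszul hη hx hg, Finset.sum_mul, Finset.mul_sum]
    rw [Finset.sum_comm]
    exact Finset.sum_congr rfl fun _ _ => Finset.sum_congr rfl fun _ _ => by ring
  have h4 : ∀ e, Chr (fun q => ind η x q) gi p e d b
      = ∑ f, gi p e f * ipM η x (Wf η ηi x d b) (fun q j => pd f (fun q' => x q' j) q) p := by
    intro e
    simp only [← koszul hη hx hg, Finset.mul_sum]
    rw [Finset.sum_comm]
    simp only [← mul_assoc, ← Finset.sum_mul, inv_left (hg p)]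
    simp
  have h5 := normal_decomp hη hakp hN (Wf η ηi x c a) (Wf η ηi x d b) p
  simp only [← h4] at h5
  have h6 := ipM_symm hη (x := x) (Wf η ηi x d b) (Wf η ηi x c a) p
  rw [h1] at h2
  simp only [Finset.sum_add_distrib] at h2
  simp only [mul_add, Finset.sum_add_distrib]
  linarith

lemma gauss_basis {r : ℕ} {η ηi : (Fin m → ℝ) → Fin m → Fin m → ℝ}
    {x : (Fin n → ℝ) → Fin m → ℝ}
    {θ : (Fin n → ℝ) → Fin n → Fin n → ℝ} {γ2 : (Fin n → ℝ) → ℝ}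
    {gi : (Fin n → ℝ) → Fin n → Fin n → ℝ} {N : Fin r → (Fin n → ℝ) → Fin m → ℝ}
    (hη : IsMetric η ηi) (hx : SmoothEmb x) (hakp : IsAKP η x θ γ2 gi)
    (hN : NormalFrame η ηi x θ γ2 N) (a b c d : Fin n) (p : Fin n → ℝ) :
    RiemL (fun q => ind η x q) gi p a b c d
    = (∑ i, ∑ j, ∑ k, ∑ l, pd a (fun q => x q i) p * pd b (fun q => x q j) p
        * (pd c (fun q => x q k) p * pd d (fun q => x q l) p * RiemL η ηi (x p) i j k l))
      + ∑ A, (ipM η x (N A) (Wf η ηi x c a) p * ipM η x (N A) (Wf η ηi x d b) p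
          - ipM η x (N A) (Wf η ηi x d a) p * ipM η x (N A) (Wf η ηi x c b) p) := by
  have h1 := gauss_half hη hx hakp hN a b c d p
  have h2 := gauss_half hη hx hakp hN a b d c p
  have h3 : RiemL (fun q => ind η x q) gi p a b c d
      = ∑ e, ind η x p a e * (pd c (fun q => Chr (fun q => ind η x q) gi q e d b) p
      + ∑ f, Chr (fun q => ind η x q) gi p e c f * Chr (fun q => ind η x q) gi p f d b)
      - ∑ e, ind η x p a e * (pd d (fun q => Chr (fun q => ind η x q) gi q e c b) p
      + ∑ f, Chr (fun q => ind η x q) gi p e d f * Chr (fun q => ind η x q) gi p f c b) := by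
    unfold RiemL Riem
    rw [← Finset.sum_sub_distrib]
    refine Finset.sum_congr rfl fun e _ => ?_
    rw [Finset.sum_sub_distrib]; ring
  have h4 : ipM η x (fun q i => barD η ηi x (Wf η ηi x d b) q c i)
        (fun q j => pd a (fun q' => x q' j) q) p
      - ipM η x (fun q i => barD η ηi x (Wf η ηi x c b) q d i)
        (fun q j => pd a (fun q' => x q' j) q) p
      = ∑ i, ∑ j, ∑ k, ∑ l, pd a (fun q => x q i) p * pd b (fun q => x q j) p
        * (pd c (fun q => x q k) p * pd d (fun q => x q l) p * RiemL η ηi (x p) i j k l) := by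
    have h5 : ∀ V : (Fin n → ℝ) → Fin m → ℝ, ipM η x V (fun q j => pd a (fun q' => x q' j) q) p
        = ∑ i, ∑ s, pd a (fun q => x q i) p * η (x p) i s * V p s := by
      intro V
      rw [ipM_symm hη]
      unfold ipM
      refine Finset.sum_congr rfl fun _ _ => Finset.sum_congr rfl fun _ _ => by ring
    rw [h5, h5, ← Finset.sum_sub_distrib]
    refine Finset.sum_congr rfl fun i _ => ?_
    rw [← Finset.sum_sub_distrib]
    simp only [← mul_sub, curv hη hx, RiemL, Finset.mul_sum]
    rw [Finset.sum_comm]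
    refine Finset.sum_congr rfl fun j _ => ?_
    rw [Finset.sum_comm]
    refine Finset.sum_congr rfl fun k _ => ?_
    rw [Finset.sum_comm]
    refine Finset.sum_congr rfl fun l _ => Finset.sum_congr rfl fun _ _ => by ring
  rw [h3, h1, h2, ← h4, Finset.sum_sub_distrib]
  ring

/-- `K_A(e,c) = η(N_A, ∇̄_e c)` tensorially. -/
noncomputable def Kf (η ηi : (Fin m → ℝ) → Fin m → Fin m → ℝ) (x : (Fin n → ℝ) → Fin m → ℝ)
    (N : (Fin n → ℝ) → Fin m → ℝ) (e c : (Fin n → ℝ) → Fin n → ℝ) (p : Fin n → ℝ) : ℝ :=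
  ∑ a, ∑ b, e p a * c p b * ipM η x N (Wf η ηi x a b) p

lemma alg_KK (c d e f : Fin n → ℝ) (H : Fin n → Fin n → ℝ) :
    ∑ a, ∑ b, ∑ a', ∑ b', c a * d b * e a' * f b' * (H a' a * H b' b)
      = (∑ a, ∑ b, e a * c b * H a b) * (∑ a, ∑ b, f a * d b * H a b) := by
  simp only [Finset.sum_mul_sum]
  rw [s4_13, s4_24]
  refine Finset.sum_congr rfl fun _ _ => Finset.sum_congr rfl fun _ _ => ?_
  refine Finset.sum_congr rfl fun _ _ => Finset.sum_congr rfl fun _ _ => by ring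

lemma s5_out {ι : Type*} [Fintype ι] (F : Fin n → Fin n → Fin n → Fin n → ι → ℝ) :
    ∑ a, ∑ b, ∑ c, ∑ d, ∑ A, F a b c d A = ∑ A, ∑ a, ∑ b, ∑ c, ∑ d, F a b c d A := by
  have h3 : ∀ a b, ∑ c, ∑ d, ∑ A, F a b c d A = ∑ A, ∑ c, ∑ d, F a b c d A := by
    intro a b
    rw [s3_23, Finset.sum_comm]
  simp only [h3]
  rw [s3_23, Finset.sum_comm]

lemma gauss_main {r : ℕ} {η ηi : (Fin m → ℝ) → Fin m → Fin m → ℝ}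
    {x : (Fin n → ℝ) → Fin m → ℝ}
    {θ : (Fin n → ℝ) → Fin n → Fin n → ℝ} {γ2 : (Fin n → ℝ) → ℝ}
    {gi : (Fin n → ℝ) → Fin n → Fin n → ℝ} {N : Fin r → (Fin n → ℝ) → Fin m → ℝ}
    (hη : IsMetric η ηi) (hx : SmoothEmb x) (hakp : IsAKP η x θ γ2 gi)
    (hN : NormalFrame η ηi x θ γ2 N) (c d e f : (Fin n → ℝ) → Fin n → ℝ) (p : Fin n → ℝ) :
    (∑ a, ∑ b, ∑ a', ∑ b', c p a * d p b * e p a' * f p b'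
          * RiemL (fun q => ind η x q) gi p a b a' b')
        = (∑ i, ∑ j, ∑ k, ∑ l, tv x c p i * tv x d p j * tv x e p k * tv x f p l
            * RiemL η ηi (x p) i j k l)
          + ∑ A, (Kf η ηi x (N A) e c p * Kf η ηi x (N A) f d p
            - Kf η ηi x (N A) f c p * Kf η ηi x (N A) e d p) := by
  simp only [gauss_basis hη hx hakp hN, mul_add, Finset.sum_add_distrib]
  congr 1
  · have q1 : ∀ i j, ∑ k, ∑ l, tv x c p i * tv x d p j * tv x e p k * tv x f p l
            * RiemL η ηi (x p) i j k l = tv x c p i * tv x d p j *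
              ∑ a', ∑ b', e p a' * f p b' * ∑ k, ∑ l, pd a' (fun q => x q k) p
                * pd b' (fun q => x q l) p * RiemL η ηi (x p) i j k l := by
      intro i j
      rw [← quad (e p) (f p) (fun a k => pd a (fun q => x q k) p)
        (fun a k => pd a (fun q => x q k) p) (fun k l => RiemL η ηi (x p) i j k l)]
      simp only [Finset.mul_sum (Finset.univ : Finset (Fin m))]
      unfold tv
      refine Finset.sum_congr rfl fun _ _ => Finset.sum_congr rfl fun _ _ => by ring
    simp only [q1]
    have q2 := quad (c p) (d p) (fun a k => pd a (fun q => x q k) p)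
        (fun a k => pd a (fun q => x q k) p)
        (fun i j => ∑ a', ∑ b', e p a' * f p b' * ∑ k, ∑ l, pd a' (fun q => x q k) p
                * pd b' (fun q => x q l) p * RiemL η ηi (x p) i j k l)
    refine Eq.trans ?_ q2.symm
    refine Finset.sum_congr rfl fun a _ => Finset.sum_congr rfl fun b _ => ?_
    simp only [Finset.mul_sum]
    symm
    refine (s4_13 _).trans ((s4_24 _).trans ?_)
    refine Finset.sum_congr rfl fun _ _ => Finset.sum_congr rfl fun _ _ => ?_
    refine Finset.sum_congr rfl fun _ _ => Finset.sum_congr rfl fun _ _ => ?_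
    refine Finset.sum_congr rfl fun _ _ => Finset.sum_congr rfl fun _ _ => by ring
  · simp only [Finset.mul_sum]
    rw [s5_out]
    refine Finset.sum_congr rfl fun A _ => ?_
    unfold Kf
    rw [← alg_KK (c p) (d p) (e p) (f p) (fun a b => ipM η x (N A) (Wf η ηi x a b) p),
      ← alg_KK (c p) (d p) (f p) (e p) (fun a b => ipM η x (N A) (Wf η ηi x a b) p)]
    rw [s4_34 (fun a b a' b' => c p a * d p b * f p a' * e p b' *
      (ipM η x (N A) (Wf η ηi x a' a) p * ipM η x (N A) (Wf η ηi x b' b) p))]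
    simp only [← Finset.sum_sub_distrib]
    refine Finset.sum_congr rfl fun _ _ => Finset.sum_congr rfl fun _ _ => ?_
    refine Finset.sum_congr rfl fun _ _ => Finset.sum_congr rfl fun _ _ => by ring

lemma low_smooth {η ηi : (Fin m → ℝ) → Fin m → Fin m → ℝ} {x : (Fin n → ℝ) → Fin m → ℝ}
    (hη : IsMetric η ηi) (hx : SmoothEmb x) {V : (Fin n → ℝ) → Fin m → ℝ}
    (hV : ∀ i, ContDiff ℝ (⊤ : ℕ∞) fun q => V q i) (i : Fin m) :
    ContDiff ℝ (⊤ : ℕ∞) fun q => low η x V q i := by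
  unfold low
  exact ContDiff.sum fun j _ => ((hη.1 i j).comp (emb_smooth hx)).mul (hV j)

lemma normal_E {r : ℕ} {η ηi : (Fin m → ℝ) → Fin m → Fin m → ℝ} {x : (Fin n → ℝ) → Fin m → ℝ}
    {θ : (Fin n → ℝ) → Fin n → Fin n → ℝ} {γ2 : (Fin n → ℝ) → ℝ}
    {N : Fin r → (Fin n → ℝ) → Fin m → ℝ} (hN : NormalFrame η ηi x θ γ2 N)
    (A : Fin r) (a : Fin n) (p : Fin n → ℝ) :
    ipM η x (N A) (fun q j => pd a (fun q' => x q' j) q) p = 0 := hN.2.2.1 A p a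

lemma shape {r : ℕ} {η ηi : (Fin m → ℝ) → Fin m → Fin m → ℝ} {x : (Fin n → ℝ) → Fin m → ℝ}
    {θ : (Fin n → ℝ) → Fin n → Fin n → ℝ} {γ2 : (Fin n → ℝ) → ℝ}
    {N : Fin r → (Fin n → ℝ) → Fin m → ℝ}
    (hη : IsMetric η ηi) (hx : SmoothEmb x) (hN : NormalFrame η ηi x θ γ2 N)
    (A : Fin r) (a b : Fin n) (p : Fin n → ℝ) :
    ipM η x (fun q i => barD η ηi x (N A) q a i) (fun q j => pd b (fun q' => x q' j) q) p
      = - ipM η x (N A) (Wf η ηi x a b) p := by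
  have h := compatAlong hη hx (hN.1 A) (fun i => pd_smooth b (hx i)) a p
  simp only [normal_E hN, pd_const'] at h
  have : ipM η x (N A) (fun q i => barD η ηi x (fun q j => pd b (fun q' => x q' j) q) q a i) p
    = ipM η x (N A) (Wf η ηi x a b) p := rfl
  linarith

lemma low_tv {η : (Fin m → ℝ) → Fin m → Fin m → ℝ} {x : (Fin n → ℝ) → Fin m → ℝ}
    (c : (Fin n → ℝ) → Fin n → ℝ) (V : (Fin n → ℝ) → Fin m → ℝ)
    (p : Fin n → ℝ) :
    ∑ j, V p j * low η x (tv x c) p j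
      = ∑ b, c p b * ipM η x V (fun q j => pd b (fun q' => x q' j) q) p := by
  unfold low tv ipM
  simp only [Finset.mul_sum]
  rw [s3_23, Finset.sum_comm]
  refine Finset.sum_congr rfl fun _ _ => ?_
  refine Finset.sum_congr rfl fun _ _ => Finset.sum_congr rfl fun _ _ => by ring

lemma Bmap_eq {r : ℕ} {η ηi : (Fin m → ℝ) → Fin m → Fin m → ℝ} {x : (Fin n → ℝ) → Fin m → ℝ}
    {θ : (Fin n → ℝ) → Fin n → Fin n → ℝ} {γ2 : (Fin n → ℝ) → ℝ}
    {gi : (Fin n → ℝ) → Fin n → Fin n → ℝ} {N : Fin r → (Fin n → ℝ) → Fin m → ℝ}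
    (hη : IsMetric η ηi) (hx : SmoothEmb x) (hakp : IsAKP η x θ γ2 gi)
    (hN : NormalFrame η ηi x θ γ2 N) (A : Fin r) (c e : (Fin n → ℝ) → Fin n → ℝ)
    (p : Fin n → ℝ) :
    (∑ i, ∑ l, η (x p) i l
        * (∑ j, ∑ k, Bmap η ηi x θ γ2 (N A) p i j * η (x p) j k * tv x c p k)
        * tv x e p l) = γ2 p * Kf η ηi x (N A) e c p := by
  have h1 : (∑ i, ∑ l, η (x p) i l
        * (∑ j, ∑ k, Bmap η ηi x θ γ2 (N A) p i j * η (x p) j k * tv x c p k)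
        * tv x e p l) = - γ2 p * ∑ j, (∑ i, low η x (tv x e) p i * nhV η ηi x θ γ2 (N A) p i j)
          * low η x (tv x c) p j := by
    have h2 : ∀ i, ∑ j, ∑ k, Bmap η ηi x θ γ2 (N A) p i j * η (x p) j k * tv x c p k
        = ∑ j, (- γ2 p * nhV η ηi x θ γ2 (N A) p i j) * low η x (tv x c) p j := by
      intro i
      refine Finset.sum_congr rfl fun j _ => ?_
      unfold low Bmap
      rw [Finset.mul_sum]
      exact Finset.sum_congr rfl fun _ _ => by ring
    have h3 : ∀ i (S : ℝ), ∑ l, η (x p) i l * S * tv x e p l = low η x (tv x e) p i * S := by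
      intro i S
      unfold low
      rw [Finset.sum_mul]
      exact Finset.sum_congr rfl fun _ _ => by ring
    simp only [h2, h3]
    simp only [Finset.sum_mul, Finset.mul_sum]
    rw [Finset.sum_comm]
    exact Finset.sum_congr rfl fun _ _ => Finset.sum_congr rfl fun _ _ => by ring
  rw [h1]
  simp only [nhV_eq hakp, contr hakp]
  have h4 : ∑ j, (∑ a, e p a * barD η ηi x (N A) p a j) * low η x (tv x c) p j
      = ∑ a, e p a * ∑ b, c p b * ipM η x (fun q i => barD η ηi x (N A) q a i)
        (fun q j => pd b (fun q' => x q' j) q) p := by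
    simp only [← low_tv]
    simp only [Finset.sum_mul, Finset.mul_sum]
    rw [Finset.sum_comm]
    exact Finset.sum_congr rfl fun _ _ => Finset.sum_congr rfl fun _ _ => by ring
  rw [h4]
  simp only [shape hη hx hN, Kf, Finset.mul_sum]
  exact Finset.sum_congr rfl fun _ _ => Finset.sum_congr rfl fun _ _ => by ring

lemma PiL_deriv {r : ℕ} {η ηi : (Fin m → ℝ) → Fin m → Fin m → ℝ} {x : (Fin n → ℝ) → Fin m → ℝ}
    {θ : (Fin n → ℝ) → Fin n → Fin n → ℝ} {γ2 : (Fin n → ℝ) → ℝ}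
    {N : Fin r → (Fin n → ℝ) → Fin m → ℝ}
    (hη : IsMetric η ηi) (hx : SmoothEmb x) (hN : NormalFrame η ηi x θ γ2 N)
    (a b : Fin n) (k : Fin m) (p : Fin n → ℝ) :
    ∑ i, pd b (fun q => x q i) p * barD02 η ηi x (fun q => PiL η x θ γ2 q) p a i k
      = - ∑ A, ipM η x (N A) (Wf η ηi x a b) p * low η x (N A) p k := by
  have hs : ∀ i k, ContDiff ℝ (⊤ : ℕ∞) fun q => PiL η x θ γ2 q i k := by
    intro i k
    simp only [PiL_eq hη hN]
    exact ContDiff.sum fun A _ => (low_smooth hη hx (hN.1 A) i).mul (low_smooth hη hx (hN.1 A) k)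
  have hz : ∀ q k, ∑ i, pd b (fun q' => x q' i) q * PiL η x θ γ2 q i k = 0 := by
    intro q k
    simp only [PiL_eq hη hN, Finset.mul_sum, ← mul_assoc]
    rw [Finset.sum_comm]
    simp only [← Finset.sum_mul]
    have : ∀ A, ∑ i, pd b (fun q' => x q' i) q * low η x (N A) q i = 0 := by
      intro A
      have h := normal_E hN A b q
      rw [ipM_symm hη, ipM_low] at h
      exact h
    simp [this]
  have h1 : ∑ i, (pd a (fun q => pd b (fun q' => x q' i) q) p * PiL η x θ γ2 p i k
      + pd b (fun q' => x q' i) p * pd a (fun q => PiL η x θ γ2 q i k) p) = 0 := by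
    have h2 : pd a (fun q => ∑ i, pd b (fun q' => x q' i) q * PiL η x θ γ2 q i k) p = 0 := by
      simp only [hz, pd_const']
    rw [pd_sum' a p (fun i => sm_diff ((pd_smooth b (hx i)).mul (hs i k)) p)] at h2
    rw [← h2]
    exact Finset.sum_congr rfl fun i _ =>
      (pd_mul' a p (sm_diff (pd_smooth b (hx i)) p) (sm_diff (hs i k) p)).symm
  have h3 : ∑ i, pd b (fun q => x q i) p * (∑ l, ∑ l', Chr η ηi (x p) l' l k
      * pd a (fun q => x q l) p * PiL η x θ γ2 p i l') = 0 := by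
    simp only [Finset.mul_sum]
    rw [Finset.sum_comm]
    refine Finset.sum_eq_zero fun l _ => ?_
    rw [Finset.sum_comm]
    refine Finset.sum_eq_zero fun l' _ => ?_
    have := hz p l'
    calc _ = Chr η ηi (x p) l' l k * pd a (fun q => x q l) p *
        ∑ i, pd b (fun q' => x q' i) p * PiL η x θ γ2 p i l' := by
          rw [Finset.mul_sum]
          exact Finset.sum_congr rfl fun _ _ => by ring
      _ = 0 := by rw [this, mul_zero]
  have h4 : ∑ i, pd b (fun q => x q i) p * (∑ l, ∑ l', Chr η ηi (x p) l' l i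
      * pd a (fun q => x q l) p * PiL η x θ γ2 p l' k)
      = ∑ i, (∑ l, ∑ l', Chr η ηi (x p) i l l' * pd a (fun q => x q l) p
        * pd b (fun q => x q l') p) * PiL η x θ γ2 p i k := by
    simp only [Finset.mul_sum, Finset.sum_mul]
    rw [s3_13]
    exact Finset.sum_congr rfl fun _ _ => Finset.sum_congr rfl fun _ _ =>
      Finset.sum_congr rfl fun _ _ => by ring
  have h5 : ∑ A, ipM η x (N A) (Wf η ηi x a b) p * low η x (N A) p k
      = ∑ i, Wf η ηi x a b p i * PiL η x θ γ2 p i k := by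
    simp only [fun A => ipM_symm hη (x := x) (N A) (Wf η ηi x a b) p, ipM_low, PiL_eq hη hN,
      Finset.mul_sum, Finset.sum_mul]
    rw [Finset.sum_comm]
    exact Finset.sum_congr rfl fun _ _ => Finset.sum_congr rfl fun _ _ => by ring
  rw [h5]
  unfold barD02 Wf barD
  simp only [mul_sub, add_mul, Finset.sum_sub_distrib, Finset.sum_add_distrib] at h1 ⊢
  rw [h3, h4]
  linarith

/-- `Z^k X^i ∇̂_k Π_{im} = - Σ_A K_A(Z,X) (N_A)_m`. -/
lemma Q_eq {r : ℕ} {η ηi : (Fin m → ℝ) → Fin m → Fin m → ℝ} {x : (Fin n → ℝ) → Fin m → ℝ}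
    {θ : (Fin n → ℝ) → Fin n → Fin n → ℝ} {γ2 : (Fin n → ℝ) → ℝ}
    {gi : (Fin n → ℝ) → Fin n → Fin n → ℝ} {N : Fin r → (Fin n → ℝ) → Fin m → ℝ}
    (hη : IsMetric η ηi) (hx : SmoothEmb x) (hakp : IsAKP η x θ γ2 gi)
    (hN : NormalFrame η ηi x θ γ2 N) (c e : (Fin n → ℝ) → Fin n → ℝ)
    (p : Fin n → ℝ) (m' : Fin m) :
    ∑ i, ∑ k, tv x c p i * low η x (tv x e) p k
        * nhT02 η ηi x θ γ2 (fun q => PiL η x θ γ2 q) p k i m'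
      = - ∑ A, Kf η ηi x (N A) e c p * low η x (N A) p m' := by
  have h1 : ∀ i, ∑ k, tv x c p i * low η x (tv x e) p k
        * nhT02 η ηi x θ γ2 (fun q => PiL η x θ γ2 q) p k i m'
      = tv x c p i * ∑ a, e p a * barD02 η ηi x (fun q => PiL η x θ γ2 q) p a i m' := by
    intro i
    simp only [nhT02_eq hakp]
    rw [← contr hakp, Finset.mul_sum]
    exact Finset.sum_congr rfl fun _ _ => by ring
  simp only [h1]
  have h2 : ∑ i, tv x c p i * ∑ a, e p a * barD02 η ηi x (fun q => PiL η x θ γ2 q) p a i m'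
      = ∑ a, ∑ b, e p a * c p b * ∑ i, pd b (fun q => x q i) p
        * barD02 η ηi x (fun q => PiL η x θ γ2 q) p a i m' := by
    unfold tv
    simp only [Finset.mul_sum, Finset.sum_mul]
    rw [Finset.sum_comm, s3_23]
    exact Finset.sum_congr rfl fun _ _ => Finset.sum_congr rfl fun _ _ =>
      Finset.sum_congr rfl fun _ _ => by ring
  rw [h2]
  simp only [PiL_deriv hη hx hN, Kf, Finset.sum_mul, Finset.mul_sum, mul_neg,
    Finset.sum_neg_distrib]
  congr 1
  rw [s3_23, Finset.sum_comm]
  exact Finset.sum_congr rfl fun _ _ => Finset.sum_congr rfl fun _ _ =>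
      Finset.sum_congr rfl fun _ _ => by ring

lemma ηi_contr {r : ℕ} {η ηi : (Fin m → ℝ) → Fin m → Fin m → ℝ} {x : (Fin n → ℝ) → Fin m → ℝ}
    {θ : (Fin n → ℝ) → Fin n → Fin n → ℝ} {γ2 : (Fin n → ℝ) → ℝ}
    {N : Fin r → (Fin n → ℝ) → Fin m → ℝ}
    (hη : IsMetric η ηi) (hN : NormalFrame η ηi x θ γ2 N) (p : Fin n → ℝ) (u v : Fin r → ℝ) :
    ∑ m', ∑ m'', (- ∑ A, u A * low η x (N A) p m') * (- ∑ A, v A * low η x (N A) p m'')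
      * ηi (x p) m' m'' = ∑ A, u A * v A := by
  simp only [neg_mul_neg]
  rw [quad u v (fun A i => low η x (N A) p i) (fun A i => low η x (N A) p i) (ηi (x p))]
  have h1 : ∀ A B, ∑ k, ∑ l, low η x (N A) p k * low η x (N B) p l * ηi (x p) k l
      = if A = B then (1:ℝ) else 0 := by
    intro A B
    rw [← hN.2.1 A B p, ipM_symm hη, ipM_low]
    refine Finset.sum_congr rfl fun k _ => ?_
    rw [← raise_low hη (N B) p k, Finset.sum_mul]
    exact Finset.sum_congr rfl fun _ _ => by ring
  simp [h1]

lemma alg_Pi (X Y Z V : Fin m → ℝ) (h : Fin m → Fin m → ℝ) (T : Fin m → Fin m → Fin m → ℝ) :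
    ∑ i, ∑ j, ∑ k, ∑ l, X i * Y j * Z k * V l * ∑ m', ∑ m'', h m' m'' * (T k i m' * T l j m'')
      = ∑ m', ∑ m'', (∑ i, ∑ k, X i * Z k * T k i m') * (∑ j, ∑ l, Y j * V l * T l j m'')
        * h m' m'' := by
  have h1 : ∀ m' m'', (∑ i, ∑ k, X i * Z k * T k i m') * (∑ j, ∑ l, Y j * V l * T l j m'')
        * h m' m'' = ∑ i, ∑ j, ∑ k, ∑ l, X i * Y j * Z k * V l * (h m' m'' * (T k i m' * T l j m'')) := by
    intro m' m''
    simp only [Finset.sum_mul_sum]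
    simp only [Finset.sum_mul]
    refine Finset.sum_congr rfl fun _ _ => Finset.sum_congr rfl fun _ _ => ?_
    refine Finset.sum_congr rfl fun _ _ => Finset.sum_congr rfl fun _ _ => by ring
  simp only [h1]
  simp only [Finset.mul_sum]
  rw [s5_out]
  refine Finset.sum_congr rfl fun _ _ => ?_
  rw [s5_out]

lemma alg_Pi2 (X Y Z V : Fin m → ℝ) (h : Fin m → Fin m → ℝ) (T : Fin m → Fin m → Fin m → ℝ) :
    ∑ i, ∑ j, ∑ k, ∑ l, X i * Y j * Z k * V l
        * ∑ m', ∑ m'', h m' m'' * (T k i m' * T l j m'' - T l i m' * T k j m'')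
      = ∑ m', ∑ m'', (∑ i, ∑ k, X i * Z k * T k i m') * (∑ j, ∑ l, Y j * V l * T l j m'')
        * h m' m''
      - ∑ m', ∑ m'', (∑ i, ∑ k, X i * V k * T k i m') * (∑ j, ∑ l, Y j * Z l * T l j m'')
        * h m' m'' := by
  rw [← alg_Pi, ← alg_Pi X Y V Z]
  rw [s4_34 (fun i j k l => X i * Y j * V k * Z l
        * ∑ m', ∑ m'', h m' m'' * (T k i m' * T l j m''))]
  rw [← Finset.sum_sub_distrib]
  refine Finset.sum_congr rfl fun i _ => ?_
  rw [← Finset.sum_sub_distrib]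
  refine Finset.sum_congr rfl fun j _ => ?_
  rw [← Finset.sum_sub_distrib]
  refine Finset.sum_congr rfl fun k _ => ?_
  rw [← Finset.sum_sub_distrib]
  refine Finset.sum_congr rfl fun l _ => ?_
  have h1 : ∑ m', ∑ m'', h m' m'' * (T k i m' * T l j m'' - T l i m' * T k j m'')
      = ∑ m', ∑ m'', h m' m'' * (T k i m' * T l j m'')
        - ∑ m', ∑ m'', h m' m'' * (T l i m' * T k j m'') := by
    simp only [mul_sub, Finset.sum_sub_distrib]
  rw [h1]
  ring

/-- Gauss' equation in Poisson-bracket form: for tangent `X,Y,Z,V`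
(with coefficients `c,d,e,f`),
`R(X,Y,Z,V) = X^iY^jZ^kV^l [R̄_{ijkl} + (∇̂_kΠ_{im})(∇̂_lΠ_j^m) − (∇̂_lΠ_{im})(∇̂_kΠ^m_j)]
 = R̄(X,Y,Z,V) + γ^{-4} Σ_A [η(B_A X,Z)η(B_A Y,V) − η(B_A X,V)η(B_A Y,Z)]`. -/
theorem statement_7 {n m r : ℕ}
    (η ηi : (Fin m → ℝ) → Fin m → Fin m → ℝ) (x : (Fin n → ℝ) → Fin m → ℝ)
    (θ : (Fin n → ℝ) → Fin n → Fin n → ℝ) (γ2 : (Fin n → ℝ) → ℝ)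
    (gi : (Fin n → ℝ) → Fin n → Fin n → ℝ)
    (N : Fin r → (Fin n → ℝ) → Fin m → ℝ)
    (hη : IsMetric η ηi) (hx : SmoothEmb x) (hakp : IsAKP η x θ γ2 gi)
    (hN : NormalFrame η ηi x θ γ2 N) :
    ∀ (c d e f : (Fin n → ℝ) → Fin n → ℝ) (p : Fin n → ℝ),
      ((∑ a, ∑ b, ∑ a', ∑ b', c p a * d p b * e p a' * f p b'
          * RiemL (fun q => ind η x q) gi p a b a' b')
        = (∑ i, ∑ j, ∑ k, ∑ l, tv x c p i * tv x d p j * tv x e p k * tv x f p l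
            * RiemL η ηi (x p) i j k l)
          + ∑ i, ∑ j, ∑ k, ∑ l,
              tv x c p i * tv x d p j * low η x (tv x e) p k * low η x (tv x f) p l
              * ∑ m', ∑ m'', ηi (x p) m' m''
                * (nhT02 η ηi x θ γ2 (fun q => PiL η x θ γ2 q) p k i m'
                     * nhT02 η ηi x θ γ2 (fun q => PiL η x θ γ2 q) p l j m''
                   - nhT02 η ηi x θ γ2 (fun q => PiL η x θ γ2 q) p l i m'
                     * nhT02 η ηi x θ γ2 (fun q => PiL η x θ γ2 q) p k j m'')) ∧
      ((∑ a, ∑ b, ∑ a', ∑ b', c p a * d p b * e p a' * f p b'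
          * RiemL (fun q => ind η x q) gi p a b a' b')
        = (∑ i, ∑ j, ∑ k, ∑ l, tv x c p i * tv x d p j * tv x e p k * tv x f p l
            * RiemL η ηi (x p) i j k l)
          + ((γ2 p) ^ 2)⁻¹ * ∑ A,
              ((∑ i, ∑ l, η (x p) i l
                  * (∑ j, ∑ k, Bmap η ηi x θ γ2 (N A) p i j * η (x p) j k * tv x c p k)
                  * tv x e p l)
               * (∑ i, ∑ l, η (x p) i l
                  * (∑ j, ∑ k, Bmap η ηi x θ γ2 (N A) p i j * η (x p) j k * tv x d p k)
                  * tv x f p l)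
             - (∑ i, ∑ l, η (x p) i l
                  * (∑ j, ∑ k, Bmap η ηi x θ γ2 (N A) p i j * η (x p) j k * tv x c p k)
                  * tv x f p l)
               * (∑ i, ∑ l, η (x p) i l
                  * (∑ j, ∑ k, Bmap η ηi x θ γ2 (N A) p i j * η (x p) j k * tv x d p k)
                  * tv x e p l))) := by
  intro c d e f p
  have hG := gauss_main hη hx hakp hN c d e f p
  refine ⟨?_, ?_⟩
  · rw [hG]
    congr 1
    have hP := alg_Pi2 (tv x c p) (tv x d p) (low η x (tv x e) p) (low η x (tv x f) p) (ηi (x p))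
      (fun k i m' => nhT02 η ηi x θ γ2 (fun q => PiL η x θ γ2 q) p k i m')
    refine Eq.trans ?_ hP.symm
    simp only [Q_eq hη hx hakp hN]
    rw [ηi_contr hη hN p (fun A => Kf η ηi x (N A) e c p) (fun A => Kf η ηi x (N A) f d p),
      ηi_contr hη hN p (fun A => Kf η ηi x (N A) f c p) (fun A => Kf η ηi x (N A) e d p)]
    rw [Finset.sum_sub_distrib]
  · rw [hG]
    congr 1
    simp only [Bmap_eq hη hx hakp hN]
    rw [Finset.mul_sum]
    have hpos := (hakp.2.2.2.2.2.1 p).ne'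
    refine Finset.sum_congr rfl fun A _ => ?_
    field_simp


end KP
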